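/- arXiv:2305.17579 — 5 statements merged into one kernel-verified Lean document; each statement's English description precedes it below -/
import Mathlib

section
/- Let V be a finite-dimensional F-vector space equipped with a 𝔪-adic norm ‖·‖, let π ∈ F be a uniformizer and set ε = |π| ∈ (0,1). Then the image of the norm function ‖·‖ : V → ℝ≥0 has the form r_1·ε^ℤ ∪ … ∪ r_m·ε^ℤ ∪ {0} for some real numbers r_1, …, r_m ∈ (ε, 1] with m ≤ dim_F V, where r·ε^ℤ denotes the set {r·ε^k : k ∈ ℤ}. -/
lemma eq_of_mul_zpow_eq {ε a b : ℝ} (h0 : 0 < ε) (h1 : ε < 1) (ha : ε < a) (ha1 : a ≤ 1)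
    (hb : ε < b) (hb1 : b ≤ 1) {k l : ℤ} (h : ε ^ k * a = ε ^ l * b) : a = b := by
  have key : ∀ {a b : ℝ} {k l : ℤ}, ε < a → b ≤ 1 → k < l → ε ^ l * b < ε ^ k * a := by
    intro a b k l ha hb hkl
    calc ε ^ l * b ≤ ε ^ l := mul_le_of_le_one_right (zpow_pos h0 l).le hb
      _ ≤ ε ^ (k + 1) := zpow_le_zpow_right_of_le_one₀ h0 h1.le hkl
      _ = ε ^ k * ε := zpow_add_one₀ h0.ne' k
      _ < ε ^ k * a := mul_lt_mul_of_pos_left ha (zpow_pos h0 k)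
  rcases lt_trichotomy k l with hkl | rfl | hkl
  · exact absurd h (key ha hb1 hkl).ne'
  · exact mul_left_cancel₀ (zpow_pos h0 k).ne' h
  · exact absurd h (key hb ha1 hkl).ne

lemma exists_mul_zpow_mem_Ioc {ε x : ℝ} (h0 : 0 < ε) (h1 : ε < 1) (hx : 0 < x) :
    ∃ k : ℤ, x * ε ^ k ∈ Set.Ioc ε 1 := by
  obtain ⟨n, hn, hn'⟩ := exists_mem_Ioc_zpow hx ((one_lt_inv₀ h0).2 h1)
  have hp := zpow_pos h0 (n + 1)
  refine ⟨n + 1, ?_, ?_⟩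
  · calc ε = ε⁻¹ ^ n * ε ^ (n + 1) := by
          rw [inv_zpow, zpow_add_one₀ h0.ne', inv_mul_cancel_left₀ (zpow_pos h0 n).ne']
      _ < x * ε ^ (n + 1) := mul_lt_mul_of_pos_right hn hp
  · calc x * ε ^ (n + 1) ≤ ε⁻¹ ^ (n + 1) * ε ^ (n + 1) := mul_le_mul_of_nonneg_right hn' hp.le
      _ = 1 := by rw [inv_zpow, inv_mul_cancel₀ hp.ne']

lemma ultrametric_add_eq_right {V : Type*} [AddCommGroup V] {N : V → ℝ}
    (hneg : ∀ w, N (-w) = N w) (hNu : ∀ w w', N (w + w') ≤ max (N w) (N w'))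
    {v w : V} (h : N v < N w) : N (v + w) = N w := by
  refine le_antisymm ((hNu v w).trans_eq (max_eq_right h.le)) ?_
  have := hNu (-v) (v + w)
  rw [neg_add_cancel_left, hneg] at this
  exact (le_max_iff.1 this).resolve_left h.not_ge

lemma exists_ultrametric_sum_eq {V ι : Type*} [AddCommGroup V] {N : V → ℝ}
    (hneg : ∀ w, N (-w) = N w) (hNu : ∀ w w', N (w + w') ≤ max (N w) (N w'))
    (f : ι → V) {s : Finset ι} (hs : s.Nonempty) (hinj : Set.InjOn (fun i => N (f i)) s) :
    ∃ i ∈ s, N (∑ j ∈ s, f j) = N (f i) := by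
  induction hs using Finset.Nonempty.cons_induction with
  | singleton a => exact ⟨a, by simp⟩
  | cons a s ha hs ih =>
    obtain ⟨i, hi, hsum⟩ := ih (hinj.mono (by simp))
    rw [Finset.sum_cons]
    have hne : N (f a) ≠ N (f i) := fun h =>
      ha (hinj (by simp) (by simp [hi]) h ▸ hi)
    rcases hne.lt_or_gt with h | h
    · refine ⟨i, by simp [hi], ?_⟩
      rw [ultrametric_add_eq_right hneg hNu (hsum ▸ h), hsum]
    · refine ⟨a, by simp, ?_⟩
      rw [add_comm, ultrametric_add_eq_right hneg hNu (hsum ▸ h)]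

/-- Let `F` be a field equipped with an absolute value `|·| : F → ℝ` arising from a nontrivial
discrete valuation: there is a uniformizer `π` with `0 < |π| < 1` such that the values of
`|·|` on `F^×` are exactly the integer powers of `ε = |π|`.  Let `V` be a finite-dimensional
`F`-vector space with an `𝔪`-adic norm `‖·‖` (nonnegative, vanishing exactly at `0`,
ultrametric, and `|·|`-homogeneous).  Then the image of the norm function has the form
`r₁·ε^ℤ ∪ ⋯ ∪ r_m·ε^ℤ ∪ {0}` for some reals `r₁, …, r_m ∈ (ε, 1]` with `m ≤ dim_F V`. -/
theorem norm_values_of_finite_dimensional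
    (F : Type*) [Field F] (abv : AbsoluteValue F ℝ)
    (π : F) (hπ0 : 0 < abv π) (hπ1 : abv π < 1)
    (hdisc : ∀ x : F, x ≠ 0 → ∃ k : ℤ, abv x = abv π ^ k)
    (V : Type*) [AddCommGroup V] [Module F V] [FiniteDimensional F V]
    (N : V → ℝ)
    (hN0 : ∀ w : V, 0 ≤ N w)
    (hNz : ∀ w : V, N w = 0 ↔ w = 0)
    (hNu : ∀ w w' : V, N (w + w') ≤ max (N w) (N w'))
    (hNs : ∀ (x : F) (w : V), N (x • w) = abv x * N w) :
    ∃ (m : ℕ) (r : Fin m → ℝ), m ≤ Module.finrank F V ∧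
      (∀ i, abv π < r i ∧ r i ≤ 1) ∧
      Set.range N = {0} ∪ ⋃ i : Fin m, {y : ℝ | ∃ k : ℤ, y = r i * abv π ^ k} := by
  have hneg : ∀ w, N (-w) = N w := fun w => by
    rw [← neg_one_smul F w, hNs, abv.map_neg, abv.map_one, one_mul]
  let S : Set ℝ := Set.range N ∩ Set.Ioc (abv π) 1
  choose v hv using fun s : S => s.2.1
  have hli : LinearIndependent F v := by
    rw [linearIndependent_iff']
    intro s g hg
    by_contra! hne
    classical
    let t := s.filter (fun i => g i ≠ 0)
    have ht : t.Nonempty :=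
      hne.imp fun i hi => Finset.mem_filter.2 hi
    have hinj : Set.InjOn (fun i => N (g i • v i)) t := by
      intro i hi j hj hij
      obtain ⟨k, hk⟩ := hdisc (g i) (Finset.mem_filter.1 hi).2
      obtain ⟨l, hl⟩ := hdisc (g j) (Finset.mem_filter.1 hj).2
      simp only [hNs, hk, hl, hv] at hij
      exact Subtype.ext
        (eq_of_mul_zpow_eq hπ0 hπ1 i.2.2.1 i.2.2.2 j.2.2.1 j.2.2.2 hij)
    obtain ⟨i, hi, hsum⟩ := exists_ultrametric_sum_eq hneg hNu (fun i => g i • v i) ht hinj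
    have hzero : ∑ j ∈ t, g j • v j = 0 := by
      rw [← hg]
      refine Finset.sum_filter_of_ne fun j _ hj h => hj (by rw [h, zero_smul])
    rw [hzero, (hNz 0).2 rfl, hNs, hv] at hsum
    have hpos := mul_pos (abv.pos (Finset.mem_filter.1 hi).2) (hπ0.trans i.2.2.1)
    exact hpos.ne hsum
  have hfin : Finite S := hli.finite
  have := Fintype.ofFinite S
  let e := Fintype.equivFin S
  refine ⟨Fintype.card S, fun i => (e.symm i : ℝ), hli.fintype_card_le_finrank,
    fun i => (e.symm i).2.2, ?_⟩
  ext y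
  simp only [Set.mem_range, Set.mem_union, Set.mem_singleton_iff, Set.mem_iUnion,
    Set.mem_ofPred_eq]
  constructor
  · rintro ⟨w, rfl⟩
    refine or_iff_not_imp_left.2 fun hw => ?_
    obtain ⟨k, hk⟩ := exists_mul_zpow_mem_Ioc hπ0 hπ1 ((hN0 w).lt_of_ne' hw)
    have hmem : N w * abv π ^ k ∈ S := ⟨⟨π ^ k • w, by rw [hNs, map_zpow₀, mul_comm]⟩, hk⟩
    refine ⟨e ⟨_, hmem⟩, -k, ?_⟩
    rw [Equiv.symm_apply_apply, zpow_neg, mul_inv_cancel_right₀ (zpow_pos hπ0 k).ne']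
  · rintro (rfl | ⟨i, k, rfl⟩)
    · exact ⟨0, (hNz 0).2 rfl⟩
    · exact ⟨π ^ k • v (e.symm i), by rw [hNs, map_zpow₀, hv, mul_comm]⟩
end

section
/- Let V be a finite-dimensional F-vector space equipped with a 𝔪-adic norm. Then for each pair of real numbers r' > r > 0 the quotient R-module V_{≤r'}/V_{≤r} has finite length. -/
/-- The valuation ring `R = {x ∈ F : |x| ≤ 1}` of a nonarchimedean absolute value. -/
def AbsoluteValue.valRing {F : Type*} [Field F] (abv : AbsoluteValue F ℝ)
    (hna : ∀ x y : F, abv (x + y) ≤ max (abv x) (abv y)) : Subring F where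
  carrier := {x : F | abv x ≤ 1}
  mul_mem' := by
    intro a b ha hb
    simp only [Set.mem_setOf_eq, map_mul] at *
    calc abv a * abv b ≤ 1 * 1 := mul_le_mul ha hb (abv.nonneg b) zero_le_one
      _ = 1 := one_mul 1
  one_mem' := by simp [abv.map_one]
  add_mem' := by
    intro a b ha hb
    exact le_trans (hna a b) (max_le ha hb)
  zero_mem' := by simp [abv.map_zero]
  neg_mem' := by intro a ha; simpa [abv.map_neg] using ha

/-- The closed ball `V_{≤r} = {v ∈ V : ‖v‖ ≤ r}` of a `𝔪`-adic norm, as a module over the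
valuation ring `R = {x ∈ F : |x| ≤ 1}`. -/
def normBall {F : Type*} [Field F] (abv : AbsoluteValue F ℝ)
    (hna : ∀ x y : F, abv (x + y) ≤ max (abv x) (abv y))
    {V : Type*} [AddCommGroup V] [Module F V]
    (N : V → ℝ)
    (hN0 : ∀ w : V, 0 ≤ N w)
    (hNu : ∀ w w' : V, N (w + w') ≤ max (N w) (N w'))
    (hNs : ∀ (x : F) (w : V), N (x • w) = abv x * N w)
    (r : ℝ) (hr : 0 < r) :
    Submodule ↥(abv.valRing hna) V where
  carrier := {w : V | N w ≤ r}
  add_mem' := by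
    intro a b ha hb
    exact le_trans (hNu a b) (max_le ha hb)
  zero_mem' := by
    have h : N 0 = 0 := by
      have := hNs 0 0
      simpa using this
    simpa [h] using hr.le
  smul_mem' := by
    intro c w hw
    show N ((c : F) • w) ≤ r
    rw [hNs]
    calc abv (c : F) * N w ≤ 1 * r := mul_le_mul c.2 hw (hN0 w) zero_le_one
      _ = r := one_mul r

/-- If the cokernel of an endomorphism has finite length, so do the cokernels of its powers. -/
theorem LinearMap.isFiniteLength_quotient_range_pow {R M : Type*} [Ring R] [AddCommGroup M]
    [Module R M] (f : M →ₗ[R] M) (hf : IsFiniteLength R (M ⧸ LinearMap.range f)) (n : ℕ) :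
    IsFiniteLength R (M ⧸ LinearMap.range (f ^ n)) := by
  induction n with
  | zero =>
    have : Subsingleton (M ⧸ LinearMap.range (f ^ 0)) := by
      rw [Submodule.Quotient.subsingleton_iff, pow_zero]
      exact LinearMap.range_id
    exact .of_subsingleton
  | succ n ih =>
    have h₁ : LinearMap.range (f ^ n) ≤ (LinearMap.range (f ^ (n + 1))).comap f := by
      rintro _ ⟨x, rfl⟩
      exact ⟨x, by rw [pow_succ', Module.End.mul_apply]⟩
    have h₂ : LinearMap.range (f ^ (n + 1)) ≤ LinearMap.range f := by
      rintro _ ⟨x, rfl⟩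
      exact ⟨(f ^ n) x, by rw [pow_succ', Module.End.mul_apply]⟩
    have hex : LinearMap.range (Submodule.mapQ _ _ f h₁) = LinearMap.ker (Submodule.factor h₂) := by
      ext y
      obtain ⟨y, rfl⟩ := Submodule.mkQ_surjective _ y
      constructor
      · rintro ⟨z, hz⟩
        obtain ⟨z, rfl⟩ := Submodule.mkQ_surjective _ z
        rw [← hz]
        simp
      · intro hy
        obtain ⟨z, rfl⟩ : y ∈ LinearMap.range f := by simpa using hy
        exact ⟨Submodule.mkQ _ z, by simp⟩
    rw [isFiniteLength_iff_isNoetherian_isArtinian] at hf ih ⊢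
    obtain ⟨_, _⟩ := hf
    obtain ⟨_, _⟩ := ih
    exact ⟨isNoetherian_of_range_eq_ker _ _ hex, isArtinian_of_range_eq_ker _ _ hex⟩

namespace AbsoluteValue

variable {F : Type*} [Field F] (abv : AbsoluteValue F ℝ)
  (hna : ∀ x y : F, abv (x + y) ≤ max (abv x) (abv y))

theorem mem_valRing {x : F} : x ∈ abv.valRing hna ↔ abv x ≤ 1 := Iff.rfl

/-- A uniformizer generates a maximal ideal of the valuation ring. -/
theorem isMaximal_span_uniformizer (ϖ : abv.valRing hna) (hϖ0 : 0 < abv ϖ) (hϖ1 : abv ϖ < 1)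
    (hdisc : ∀ x : F, x ≠ 0 → ∃ k : ℤ, abv x = abv ϖ ^ k) :
    (Ideal.span {ϖ}).IsMaximal := by
  have hne : (ϖ : F) ≠ 0 := abv.pos_iff.mp hϖ0
  rw [Ideal.isMaximal_iff]
  constructor
  · rw [Ideal.mem_span_singleton']
    rintro ⟨a, ha⟩
    have h : abv a * abv ϖ = 1 := by
      rw [← map_mul, ← Subring.coe_mul, ha, Subring.coe_one, map_one]
    have ha1 : abv a ≤ 1 := a.2
    nlinarith
  · intro J x _ hx hxJ
    have hx0 : (x : F) ≠ 0 := by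
      intro h
      exact hx (by rw [show x = 0 from Subtype.ext h]; exact zero_mem _)
    obtain ⟨k, hk⟩ := hdisc x hx0
    rcases lt_or_ge 0 k with hk0 | hk0
    · refine absurd ?_ hx
      rw [Ideal.mem_span_singleton']
      refine ⟨⟨x / ϖ, ?_⟩, Subtype.ext (div_mul_cancel₀ _ hne)⟩
      rw [mem_valRing, map_div₀, hk, div_le_one hϖ0]
      calc abv ϖ ^ k ≤ abv ϖ ^ (1 : ℤ) := zpow_le_zpow_right_of_le_one₀ hϖ0 hϖ1.le hk0
        _ = abv ϖ := zpow_one _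
    · have hinv : (x : F)⁻¹ ∈ abv.valRing hna := by
        rw [mem_valRing, map_inv₀, hk]
        exact inv_le_one_of_one_le₀ (one_le_zpow_of_nonpos₀ hϖ0 hϖ1.le hk0)
      have h := J.mul_mem_left ⟨_, hinv⟩ hxJ
      rwa [show (⟨_, hinv⟩ * x : abv.valRing hna) = 1 from Subtype.ext (inv_mul_cancel₀ hx0)] at h

variable {V : Type*} [AddCommGroup V] [Module F V]

/-- Vectors of a submodule over the valuation ring whose residues modulo a proper ideal are
linearly independent are linearly independent over the field. -/
theorem linearIndependent_of_residue (I : Ideal (abv.valRing hna)) (hI : I ≠ ⊤)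
    (M : Submodule (abv.valRing hna) V) {ι : Type*} [Fintype ι] (v : ι → M)
    (hv : LinearIndependent (abv.valRing hna ⧸ I)
      (fun i ↦ (Submodule.Quotient.mk (v i) : M ⧸ (I • ⊤ : Submodule (abv.valRing hna) M)))) :
    LinearIndependent F (fun i ↦ (v i : V)) := by
  rw [Fintype.linearIndependent_iff] at hv ⊢
  intro c hc
  by_contra! hne
  obtain ⟨j, hj⟩ := hne
  obtain ⟨i₀, -, hi₀⟩ := Finset.exists_max_image Finset.univ (fun i ↦ abv (c i)) ⟨j, by simp⟩
  have hpos : 0 < abv (c i₀) := (abv.pos hj).trans_le (hi₀ j (by simp))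
  have hd (i : ι) : c i / c i₀ ∈ abv.valRing hna := by
    rw [mem_valRing, map_div₀, div_le_one hpos]
    exact hi₀ i (by simp)
  let d (i : ι) : abv.valRing hna := ⟨c i / c i₀, hd i⟩
  have hsum : ∑ i, d i • v i = 0 := by
    apply Subtype.ext
    calc ((∑ i, d i • v i : M) : V) = ∑ i, (c i / c i₀) • (v i : V) := by
          rw [Submodule.coe_sum]; rfl
      _ = (c i₀)⁻¹ • ∑ i, c i • (v i : V) := by
          rw [Finset.smul_sum]
          exact Finset.sum_congr rfl fun i _ ↦ by rw [smul_smul, div_eq_inv_mul]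
      _ = 0 := by rw [hc, smul_zero]
  have h := hv (fun i ↦ Ideal.Quotient.mk I (d i)) (by
    simp only [Module.Quotient.mk_smul_mk]
    have := congrArg (Submodule.mkQ (I • ⊤ : Submodule (abv.valRing hna) M)) hsum
    simpa only [map_sum, Submodule.mkQ_apply, map_zero] using this) i₀
  have hd1 : d i₀ = 1 := Subtype.ext (div_self (abv.pos_iff.mp hpos))
  rw [hd1, Ideal.Quotient.eq_zero_iff_mem] at h
  exact hI ((Ideal.eq_top_iff_one I).mpr h)

/-- A submodule over the valuation ring of a finite-dimensional vector space has a reduction of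
finite length modulo every maximal ideal. -/
theorem isFiniteLength_quotient_smul_top [FiniteDimensional F V] (I : Ideal (abv.valRing hna))
    [hI : I.IsMaximal] (M : Submodule (abv.valRing hna) V) :
    IsFiniteLength (abv.valRing hna) (M ⧸ (I • ⊤ : Submodule (abv.valRing hna) M)) := by
  let _ : Field (abv.valRing hna ⧸ I) := Ideal.Quotient.field I
  have hrank : Module.rank (abv.valRing hna ⧸ I) (M ⧸ (I • ⊤ : Submodule (abv.valRing hna) M)) ≤
      Module.finrank F V := by
    refine rank_le fun s hs ↦ ?_
    choose v hv using fun i : s ↦ Submodule.Quotient.mk_surjective _ i.1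
    have h := linearIndependent_of_residue abv hna I hI.ne_top M v (by simpa only [hv] using hs)
    simpa using h.fintype_card_le_finrank
  have : IsNoetherian (abv.valRing hna ⧸ I) (M ⧸ (I • ⊤ : Submodule (abv.valRing hna) M)) :=
    IsNoetherian.iff_rank_lt_aleph0.mpr (hrank.trans_lt Cardinal.natCast_lt_aleph0)
  have : IsArtinian (abv.valRing hna ⧸ I) (M ⧸ (I • ⊤ : Submodule (abv.valRing hna) M)) := inferInstance
  rw [← Module.length_ne_top_iff,
    Module.length_eq_of_surjective (R := abv.valRing hna ⧸ I) Ideal.Quotient.mk_surjective]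
  exact Module.length_ne_top

end AbsoluteValue

/-- Let `F` be a field with an absolute value arising from a nontrivial discrete valuation,
with valuation ring `R = {x : |x| ≤ 1}`, and let `V` be a finite-dimensional `F`-vector
space equipped with a `𝔪`-adic norm `‖·‖`.  Then for each pair of real numbers
`r' > r > 0` the quotient `R`-module `V_{≤r'}/V_{≤r}` has finite length. -/
theorem normBall_quotient_finiteLength
    (F : Type*) [Field F] (abv : AbsoluteValue F ℝ)
    (hna : ∀ x y : F, abv (x + y) ≤ max (abv x) (abv y))
    (π : F) (hπ0 : 0 < abv π) (hπ1 : abv π < 1)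
    (hdisc : ∀ x : F, x ≠ 0 → ∃ k : ℤ, abv x = abv π ^ k)
    (V : Type*) [AddCommGroup V] [Module F V] [FiniteDimensional F V]
    (N : V → ℝ)
    (hN0 : ∀ w : V, 0 ≤ N w)
    (hNz : ∀ w : V, N w = 0 ↔ w = 0)
    (hNu : ∀ w w' : V, N (w + w') ≤ max (N w) (N w'))
    (hNs : ∀ (x : F) (w : V), N (x • w) = abv x * N w)
    (r r' : ℝ) (hr : 0 < r) (hrr' : r < r') :
    IsFiniteLength ↥(abv.valRing hna)
      (↥(normBall abv hna N hN0 hNu hNs r' (hr.trans hrr')) ⧸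
        Submodule.comap (normBall abv hna N hN0 hNu hNs r' (hr.trans hrr')).subtype
          (normBall abv hna N hN0 hNu hNs r hr)) := by
  let ϖ : abv.valRing hna := ⟨π, hπ1.le⟩
  have hmax := abv.isMaximal_span_uniformizer hna ϖ hπ0 hπ1 hdisc
  set M := normBall abv hna N hN0 hNu hNs r' (hr.trans hrr')
  let f : M →ₗ[abv.valRing hna] M := LinearMap.lsmul _ M ϖ
  have hle : (Ideal.span {ϖ} • ⊤ : Submodule (abv.valRing hna) M) ≤ LinearMap.range f := by
    rw [Submodule.smul_le]
    intro a ha m _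
    obtain ⟨b, rfl⟩ := Ideal.mem_span_singleton'.mp ha
    exact ⟨b • m, by rw [mul_comm, mul_smul]; rfl⟩
  have hf : IsFiniteLength (abv.valRing hna) (M ⧸ LinearMap.range f) :=
    (abv.isFiniteLength_quotient_smul_top hna (Ideal.span {ϖ}) M).of_surjective
      (Submodule.factor_surjective hle)
  obtain ⟨n, hn⟩ := exists_pow_lt_of_lt_one (div_pos hr (hr.trans hrr')) hπ1
  refine (f.isFiniteLength_quotient_range_pow hf n).of_surjective
    (Submodule.factor_surjective ?_)
  have hN (k : ℕ) (m : M) : N ((f ^ k) m : M) = abv π ^ k * N m := by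
    induction k with
    | zero => simp
    | succ k ih =>
      rw [pow_succ', Module.End.mul_apply, pow_succ', mul_assoc, ← ih]
      exact hNs π _
  rintro _ ⟨m, rfl⟩
  change N ((f ^ n) m : M) ≤ r
  rw [hN]
  calc abv π ^ n * N m ≤ r / r' * r' :=
        mul_le_mul hn.le m.2 (hN0 _) (div_pos hr (hr.trans hrr')).le
    _ = r := div_mul_cancel₀ _ (hr.trans hrr').ne'
end

section
/- Let Λ be an A-lattice. Then the norm on Λ extends to a unique ∞-adic norm on the F_∞-vector space V_∞ = F_∞ ⊗_A Λ, i.e., there is a unique function ‖·‖ : V_∞ → ℝ≥0 with ‖w‖ = 0 iff w = 0, ‖w + w'‖ ≤ max(‖w‖, ‖w'‖), ‖x·w‖ = |x|_∞·‖w‖ for all x ∈ F_∞, whose restriction along the canonical map Λ → V_∞ is the given norm on Λ. -/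
open scoped TensorProduct

set_option linter.unusedSectionVars false

section FunctionField

open Polynomial

section ValuationRings
variable {k F : Type*} [Field k] [Field F]

/-- The valuation ring `{x | v x ≤ 1}` of a nonarchimedean absolute value. -/
def unitBall (v : AbsoluteValue F ℝ) (hv : IsNonarchimedean v) : ValuationSubring F where
  carrier := {x | v x ≤ 1}
  mul_mem' {a b} ha hb := by
    simp only [Set.mem_ofPred_eq, map_mul] at *
    exact mul_le_one₀ ha (v.nonneg b) hb
  one_mem' := by simp
  add_mem' {a b} ha hb := (hv a b).trans (max_le ha hb)
  zero_mem' := by simp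
  neg_mem' {a} ha := by simpa using ha
  mem_or_inv_mem' x := by
    by_cases h : v x ≤ 1
    · exact .inl h
    · exact .inr (by
        simp only [Set.mem_ofPred_eq, map_inv₀]
        exact inv_le_one_of_one_le₀ (le_of_not_ge h))

@[simp] lemma mem_unitBall {v : AbsoluteValue F ℝ} {hv : IsNonarchimedean v} {x : F} :
    x ∈ unitBall v hv ↔ v x ≤ 1 := Iff.rfl

lemma algebraMap_mem_valuationSubring [Finite k] [Algebra k F] (O : ValuationSubring F) (a : k) :
    algebraMap k F a ∈ O := by
  have := Fintype.ofFinite k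
  rcases eq_or_ne a 0 with rfl | ha
  · simp
  rcases O.mem_or_inv_mem (algebraMap k F a) with h | h
  · exact h
  · have hc : 2 ≤ Fintype.card k := Fintype.one_lt_card
    have h1 : a = a⁻¹ ^ (Fintype.card k - 2) := by
      have h2 := FiniteField.pow_card_sub_one_eq_one a ha
      rw [inv_pow]
      refine eq_inv_of_mul_eq_one_right ?_
      rw [← pow_succ, ← h2]
      congr 1
      omega
    rw [h1, map_pow, map_inv₀]
    exact pow_mem h _

lemma IsIntegral.mem_valuationSubring {R : Type*} [CommRing R] [Algebra R F]
    {O : ValuationSubring F} (hO : ∀ r, algebraMap R F r ∈ O) {f : F} (hf : IsIntegral R f) :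
    f ∈ O := by
  let : Algebra R O := ((algebraMap R F).codRestrict O.toSubring hO).toAlgebra
  have : IsScalarTower R O F := .of_algebraMap_eq fun _ => rfl
  obtain ⟨y, hy⟩ := IsIntegrallyClosed.isIntegral_iff.mp (hf.tower_top (A := O))
  exact hy ▸ y.2

lemma isIntegral_of_forall_mem_valuationSubring {R : Type*} [CommRing R] [Algebra R F] {f : F}
    (hf : ∀ O : ValuationSubring F, (∀ r, algebraMap R F r ∈ O) → f ∈ O) : IsIntegral R f := by
  have h := iInf_valuationSubring_superset (s := ((algebraMap R F).range : Set F))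
  have hmem : f ∈ (⨅ V : {V : ValuationSubring F // ((algebraMap R F).range : Set F) ⊆
      V.toSubring}, V.1.toSubring) := by
    rw [Subring.mem_iInf]
    exact fun V => hf V.1 fun r => V.2 ⟨r, rfl⟩
  rw [h, Subring.closure_eq] at hmem
  let : Algebra R (algebraMap R F).range := (algebraMap R F).rangeRestrict.toAlgebra
  have : IsScalarTower R (algebraMap R F).range F := .of_algebraMap_eq fun _ => rfl
  have : Algebra.IsIntegral R (algebraMap R F).range :=
    ⟨fun x => by
      obtain ⟨r, hr⟩ := (algebraMap R F).rangeRestrict_surjective x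
      exact hr ▸ isIntegral_algebraMap⟩
  exact isIntegral_trans (A := (algebraMap R F).range) f hmem

variable [Finite k] [Algebra k F] [Algebra k[X] F] [IsScalarTower k k[X] F]

lemma polynomial_mem_valuationSubring {O : ValuationSubring F}
    (hX : algebraMap k[X] F X ∈ O) (p : k[X]) : algebraMap k[X] F p ∈ O := by
  induction p using Polynomial.induction_on' with
  | add p q hp hq => rw [map_add]; exact add_mem hp hq
  | monomial n a =>
    rw [← C_mul_X_pow_eq_monomial, map_mul, map_pow, ← Polynomial.algebraMap_eq,
      ← IsScalarTower.algebraMap_apply]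
    exact mul_mem (algebraMap_mem_valuationSubring O a) (pow_mem hX n)

lemma inv_pow_mul_polynomial_mem_valuationSubring {O : ValuationSubring F}
    (hz : algebraMap k[X] F X ≠ 0) (hX : (algebraMap k[X] F X)⁻¹ ∈ O) {p : k[X]} {n : ℕ}
    (hp : p.natDegree ≤ n) :
    (algebraMap k[X] F X)⁻¹ ^ n * algebraMap k[X] F p ∈ O := by
  rw [p.as_sum_range_C_mul_X_pow, map_sum, Finset.mul_sum]
  refine sum_mem fun i hi => ?_
  rw [Finset.mem_range] at hi
  obtain ⟨j, rfl⟩ : ∃ j, n = j + i := ⟨n - i, by omega⟩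
  rw [map_mul, map_pow, ← Polynomial.algebraMap_eq, ← IsScalarTower.algebraMap_apply, pow_add]
  have : (algebraMap k[X] F X)⁻¹ ^ j * (algebraMap k[X] F X)⁻¹ ^ i *
      (algebraMap k F (p.coeff i) * algebraMap k[X] F X ^ i) =
      (algebraMap k[X] F X)⁻¹ ^ j * algebraMap k F (p.coeff i) := by
    simp only [inv_pow]
    field_simp
  rw [this]
  exact mul_mem (pow_mem hX j) (algebraMap_mem_valuationSubring O _)

/-- An element integral over `k[X]` has poles of bounded order where `X` has a pole. -/
lemma IsIntegral.exists_inv_pow_mul_mem (hz : algebraMap k[X] F X ≠ 0) {f : F}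
    (hf : IsIntegral k[X] f) :
    ∃ κ : ℕ, ∀ O : ValuationSubring F, (algebraMap k[X] F X)⁻¹ ∈ O →
      (algebraMap k[X] F X)⁻¹ ^ κ * f ∈ O := by
  obtain ⟨p, hp, hpf⟩ := hf
  refine ⟨(Finset.range p.natDegree).sup fun i => (p.coeff i).natDegree, fun O hO => ?_⟩
  rcases O.mem_or_inv_mem f with h | h
  · exact mul_mem (pow_mem hO _) h
  rcases eq_or_ne f 0 with rfl | hf0
  · simp
  rw [eval₂_eq_sum_range, Finset.sum_range_succ, hp.coeff_natDegree, map_one, one_mul] at hpf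
  rcases Nat.eq_zero_or_pos p.natDegree with h0 | h0
  · simp [h0] at hpf
  have key : f = -∑ i ∈ Finset.range p.natDegree,
      algebraMap k[X] F (p.coeff i) * f⁻¹ ^ (p.natDegree - 1 - i) := by
    have h1 : ∀ i ∈ Finset.range p.natDegree,
        algebraMap k[X] F (p.coeff i) * f⁻¹ ^ (p.natDegree - 1 - i) =
        f⁻¹ ^ (p.natDegree - 1) * (algebraMap k[X] F (p.coeff i) * f ^ i) := by
      intro i hi
      rw [Finset.mem_range] at hi
      obtain ⟨j, hj⟩ : ∃ j, p.natDegree - 1 = j + i := ⟨p.natDegree - 1 - i, by omega⟩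
      rw [hj, Nat.add_sub_cancel, pow_add]
      simp only [inv_pow]
      field_simp
    rw [Finset.sum_congr rfl h1, ← Finset.mul_sum, eq_neg_of_add_eq_zero_left hpf]
    obtain ⟨j, hj⟩ : ∃ j, p.natDegree = j + 1 := ⟨p.natDegree - 1, by omega⟩
    rw [hj, Nat.add_sub_cancel, pow_succ]
    simp only [inv_pow]
    field_simp
  rw [key, mul_neg, Finset.mul_sum]
  refine neg_mem (sum_mem fun i hi => ?_)
  rw [← mul_assoc]
  exact mul_mem (inv_pow_mul_polynomial_mem_valuationSubring hz hO
    (Finset.le_sup (f := fun i => (p.coeff i).natDegree) hi)) (pow_mem h _)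

end ValuationRings

section UnitBall
variable {k F : Type*} [Field k] [Field F] {v : AbsoluteValue F ℝ}

lemma IsNonarchimedean.apply_add_eq_left (hv : IsNonarchimedean v) {x y : F} (h : v y < v x) :
    v (x + y) = v x := by
  rw [hv.add_eq_max_of_ne' v (fun a => (v.map_neg a).symm) h.ne', max_eq_left h.le]

lemma IsNonarchimedean.apply_sum_lt (hv : IsNonarchimedean v) {ι : Type*} {s : Finset ι}
    {f : ι → F} {r : ℝ} (hr : 0 < r) (h : ∀ i ∈ s, v (f i) < r) : v (∑ i ∈ s, f i) < r :=
  Finset.sum_induction f (fun x => v x < r) (fun a b ha hb => (hv a b).trans_lt (max_lt ha hb))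
    (by simpa using hr) h

variable [Finite k] [Algebra k F] [Algebra k[X] F] [IsScalarTower k k[X] F]

lemma IsNonarchimedean.apply_algebraMap_eq_one (hv : IsNonarchimedean v) {a : k} (ha : a ≠ 0) :
    v (algebraMap k F a) = 1 := by
  refine le_antisymm (algebraMap_mem_valuationSubring (unitBall v hv) a) ?_
  have h := algebraMap_mem_valuationSubring (unitBall v hv) a⁻¹
  rw [mem_unitBall, map_inv₀, map_inv₀] at h
  exact (inv_le_one₀ (v.pos (by simpa using ha))).mp h

lemma algebraMap_C (a : k) : algebraMap k[X] F (C a) = algebraMap k F a := by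
  rw [← Polynomial.algebraMap_eq, ← IsScalarTower.algebraMap_apply]

lemma algebraMap_eq_divX (p : k[X]) :
    algebraMap k[X] F p = algebraMap k[X] F p.divX * algebraMap k[X] F X +
      algebraMap k F (p.coeff 0) := by
  conv_lhs => rw [← p.divX_mul_X_add]
  rw [map_add, map_mul, algebraMap_C]

lemma apply_algebraMap_lt_one (hv : IsNonarchimedean v) (hX : v (algebraMap k[X] F X) < 1)
    {p : k[X]} (hp : p.coeff 0 = 0) : v (algebraMap k[X] F p) < 1 := by
  rw [algebraMap_eq_divX, hp, map_zero, add_zero, map_mul]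
  exact mul_lt_one_of_nonneg_of_lt_one_right
    (polynomial_mem_valuationSubring (O := unitBall v hv) hX.le _) (v.nonneg _) hX

lemma apply_algebraMap_eq_one (hv : IsNonarchimedean v) (hX : v (algebraMap k[X] F X) < 1)
    {p : k[X]} (hp : p.coeff 0 ≠ 0) : v (algebraMap k[X] F p) = 1 := by
  rw [algebraMap_eq_divX, add_comm, hv.apply_add_eq_left, hv.apply_algebraMap_eq_one hp]
  rw [hv.apply_algebraMap_eq_one hp, map_mul]
  exact mul_lt_one_of_nonneg_of_lt_one_right
    (polynomial_mem_valuationSubring (O := unitBall v hv) hX.le _) (v.nonneg _) hX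

/-- The valuation ring of a rank one valuation is determined by its centre on the ring of
elements integral over `k[X]`. -/
lemma exists_isIntegral_apply_eq_one [Algebra.IsAlgebraic k[X] F] [Module.IsTorsionFree k[X] F]
    (hv : IsNonarchimedean v) (hX : v (algebraMap k[X] F X) < 1) {O : ValuationSubring F}
    (hO : ¬ unitBall v hv ≤ O) (hXO : algebraMap k[X] F X ∈ O) :
    ∃ b : F, IsIntegral k[X] b ∧ v b = 1 ∧ b⁻¹ ∉ O := by
  by_contra! hcon
  refine hO fun f hf => ?_
  rw [mem_unitBall] at hf
  rcases eq_or_ne f 0 with rfl | hf0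
  · simp
  classical
  obtain ⟨Q, hQ0, hQ⟩ := Algebra.IsAlgebraic.isAlgebraic (R := k[X]) f
  let := UniqueFactorizationMonoid.toNormalizedGCDMonoid k[X]
  obtain ⟨P, hP, hPf⟩ : ∃ P : k[X][X], P.IsPrimitive ∧ aeval f P = 0 :=
    ⟨Q.primPart, Q.isPrimitive_primPart, aeval_primPart_eq_zero hQ0 hQ⟩
  have hex : ∃ i, (P.coeff i).coeff 0 ≠ 0 := by
    by_contra! h
    refine not_isUnit_X (hP X ((C_dvd_iff_dvd_coeff _ _).mpr fun i => X_dvd_iff.mpr (h i)))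
  have hbdd : ∀ i, (P.coeff i).coeff 0 ≠ 0 → i ≤ P.natDegree := fun i hi =>
    le_natDegree_of_ne_zero fun h => hi (by simp [h])
  obtain ⟨i₀, hi₀⟩ := hex
  set n := Nat.findGreatest (fun i => (P.coeff i).coeff 0 ≠ 0) P.natDegree with hn
  have hn1 : (P.coeff n).coeff 0 ≠ 0 :=
    Nat.findGreatest_spec (P := fun i => (P.coeff i).coeff 0 ≠ 0) (hbdd _ hi₀) hi₀
  have hn2 : ∀ i, n < i → (P.coeff i).coeff 0 = 0 := by
    intro i hi
    by_contra h
    exact Nat.findGreatest_is_greatest hi (hbdd _ h) h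
  obtain ⟨m, hm⟩ : ∃ m, P.natDegree + 1 = n + (m + 1) :=
    ⟨P.natDegree - n, by have := hbdd _ hn1; omega⟩
  rw [aeval_eq_sum_range, hm, Finset.sum_range_add] at hPf
  simp only [Algebra.smul_def] at hPf
  set a : ℕ → F := fun i => algebraMap k[X] F (P.coeff i) with ha
  set b := ∑ j ∈ Finset.range (m + 1), a (n + j) * f ^ j with hb
  have hsum : ∑ i ∈ Finset.range n, a i * f ^ i + f ^ n * b = 0 := by
    rw [← hPf, hb, Finset.mul_sum]
    congr 1
    refine Finset.sum_congr rfl fun j _ => ?_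
    rw [pow_add]
    ring
  have hvb : v b = 1 := by
    have h1 : v (a n) = 1 := apply_algebraMap_eq_one hv hX hn1
    rw [hb, Finset.sum_range_succ', add_comm, pow_zero, mul_one, add_zero,
      hv.apply_add_eq_left, h1]
    rw [h1]
    refine hv.apply_sum_lt one_pos fun j _ => ?_
    rw [map_mul, map_pow]
    exact mul_lt_one_of_nonneg_of_lt_one_left (v.nonneg _)
      (apply_algebraMap_lt_one hv hX (hn2 _ (by omega))) (pow_le_one₀ (v.nonneg _) hf)
  have hb0 : b ≠ 0 := by
    rintro h
    simp [h] at hvb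
  have hn0 : n ≠ 0 := by
    intro h
    rw [h, Finset.range_zero, Finset.sum_empty, zero_add, pow_zero, one_mul] at hsum
    exact hb0 hsum
  have key : f * b = -∑ i ∈ Finset.range n, a i * f⁻¹ ^ (n - 1 - i) := by
    have h1 : ∀ i ∈ Finset.range n,
        a i * f⁻¹ ^ (n - 1 - i) = f⁻¹ ^ (n - 1) * (a i * f ^ i) := by
      intro i hi
      rw [Finset.mem_range] at hi
      obtain ⟨j, hj⟩ : ∃ j, n - 1 = j + i := ⟨n - 1 - i, by omega⟩
      rw [hj, Nat.add_sub_cancel, pow_add]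
      simp only [inv_pow]
      field_simp
    rw [Finset.sum_congr rfl h1, ← Finset.mul_sum, eq_neg_of_add_eq_zero_left hsum]
    obtain ⟨j, hj⟩ : ∃ j, n = j + 1 := ⟨n - 1, by omega⟩
    rw [hj, Nat.add_sub_cancel, pow_succ]
    simp only [inv_pow]
    field_simp
  have hmem : ∀ V : ValuationSubring F, (∀ r, algebraMap k[X] F r ∈ V) → b ∈ V ∧ f * b ∈ V := by
    intro V hV
    rcases V.mem_or_inv_mem f with h | h
    · have : b ∈ V := sum_mem fun j _ => mul_mem (hV _) (pow_mem h _)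
      exact ⟨this, mul_mem h this⟩
    · have : f * b ∈ V := by
        rw [key]
        exact neg_mem (sum_mem fun j _ => mul_mem (hV _) (pow_mem h _))
      exact ⟨by simpa [hf0] using mul_mem h this, this⟩
  have hbO := hcon b (isIntegral_of_forall_mem_valuationSubring fun V hV => (hmem V hV).1) hvb
  have := mul_mem (hmem O (polynomial_mem_valuationSubring hXO)).2 hbO
  rwa [mul_assoc, mul_inv_cancel₀ hb0, mul_one] at this

lemma linearIndependent_of_mod_X {M : Submodule k[X] F} [Module.IsTorsionFree k[X] F]
    {ι : Type*} [Fintype ι] {u : ι → F} (hu : ∀ i, u i ∈ M)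
    (h : ∀ c : ι → k, (∃ m ∈ M, ∑ i, algebraMap k F (c i) * u i = algebraMap k[X] F X * m) →
      ∀ i, c i = 0) :
    LinearIndependent k[X] u := by
  rw [Fintype.linearIndependent_iff]
  suffices H : ∀ n : ℕ, ∀ p : ι → k[X], ∑ i, p i • u i = 0 → ∀ i, X ^ n ∣ p i by
    intro p hp i
    by_contra h0
    have := natDegree_le_of_dvd (H ((p i).natDegree + 1) p hp i) h0
    rw [natDegree_X_pow] at this
    omega
  intro n
  induction n with
  | zero => simp
  | succ n ih =>
    intro p hp
    have hsplit : ∀ i, p i • u i = algebraMap k[X] F X * ((p i).divX • u i) +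
        algebraMap k F ((p i).coeff 0) * u i := by
      intro i
      rw [Algebra.smul_def, Algebra.smul_def, algebraMap_eq_divX]
      ring
    have hc : ∀ i, (p i).coeff 0 = 0 := by
      refine h _ ⟨-∑ i, (p i).divX • u i,
        neg_mem (sum_mem fun i _ => M.smul_mem _ (hu i)), ?_⟩
      rw [mul_neg, Finset.mul_sum, eq_neg_iff_add_eq_zero, add_comm, ← Finset.sum_add_distrib, ← hp]
      exact Finset.sum_congr rfl fun i _ => (hsplit i).symm
    have hq : ∑ i, (p i).divX • u i = 0 := by
      have h1 : (X : k[X]) • ∑ i, (p i).divX • u i = 0 := by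
        rw [← hp, Algebra.smul_def, Finset.mul_sum]
        exact Finset.sum_congr rfl fun i _ => by rw [hsplit, hc]; simp
      exact (smul_eq_zero.mp h1).resolve_left X_ne_zero
    intro i
    have h2 := (p i).divX_mul_X_add
    rw [hc i, map_zero, add_zero] at h2
    rw [← h2, pow_succ]
    exact mul_dvd_mul_right (ih _ hq i) X

end UnitBall

section Quotient
variable {k F : Type*} [Field k] [Field F] [Algebra k F] [Algebra k[X] F] [IsScalarTower k k[X] F]

/-- The quotient `M / X M`. -/
abbrev QuotX (M : Submodule k[X] F) : Type _ :=
  M ⧸ LinearMap.range (LinearMap.lsmul k[X] M X)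

lemma quotX_mk_eq_zero {M : Submodule k[X] F} {x : M} :
    (Submodule.Quotient.mk x : QuotX M) = 0 ↔ ∃ m ∈ M, (x : F) = algebraMap k[X] F X * m := by
  rw [Submodule.Quotient.mk_eq_zero, LinearMap.mem_range]
  constructor
  · rintro ⟨m, rfl⟩
    exact ⟨m, m.2, by simp [Algebra.smul_def]⟩
  · rintro ⟨m, hm, h⟩
    exact ⟨⟨m, hm⟩, Subtype.ext (by simp [Algebra.smul_def, h])⟩

lemma rank_quotX_le {M : Submodule k[X] F} {n : ℕ}
    (h : ∀ (m : ℕ) (u : Fin m → F), (∀ i, u i ∈ M) →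
      (∀ c : Fin m → k, (∃ y ∈ M, ∑ i, algebraMap k F (c i) * u i = algebraMap k[X] F X * y) →
        ∀ i, c i = 0) → m ≤ n) :
    Module.rank k (QuotX M) ≤ n := by
  refine rank_le fun s hs => ?_
  have hout : ∀ q : QuotX M, ∃ x : M, Submodule.Quotient.mk x = q :=
    Submodule.Quotient.mk_surjective _
  choose r hr using hout
  refine h s.card (fun i => r (s.equivFin.symm i)) (fun i => (r _).2) fun c hc => ?_
  have hs' := hs.comp s.equivFin.symm s.equivFin.symm.injective
  rw [Fintype.linearIndependent_iff] at hs'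
  refine hs' c ?_
  have hx : (Submodule.Quotient.mk (∑ i, c i • r (s.equivFin.symm i)) : QuotX M) = 0 := by
    rw [quotX_mk_eq_zero]
    obtain ⟨y, hy, e⟩ := hc
    refine ⟨y, hy, e ▸ ?_⟩
    simp [Algebra.smul_def]
  rw [← hx, ← Submodule.mkQ_apply, map_sum]
  refine Finset.sum_congr rfl fun i _ => ?_
  rw [Submodule.mkQ_apply, Submodule.Quotient.mk_smul, hr]
  rfl

variable [Algebra (RatFunc k) F] [IsScalarTower k[X] (RatFunc k) F]

lemma isTorsionFree_polynomial : Module.IsTorsionFree k[X] F := by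
  have h : Function.Injective (algebraMap k[X] F) := by
    rw [IsScalarTower.algebraMap_eq k[X] (RatFunc k) F]
    exact (algebraMap (RatFunc k) F).injective.comp (RatFunc.algebraMap_injective k)
  rw [← faithfulSMul_iff_algebraMap_injective] at h
  infer_instance

variable [FiniteDimensional (RatFunc k) F]

lemma isAlgebraic_polynomial : Algebra.IsAlgebraic k[X] F :=
  (IsFractionRing.comap_isAlgebraic_iff (A := k[X]) (K := RatFunc k) (C := F)).mpr inferInstance

lemma card_le_finrank {ι : Type*} [Fintype ι] {u : ι → F} (hu : LinearIndependent k[X] u) :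
    Fintype.card ι ≤ Module.finrank (RatFunc k) F :=
  ((LinearIndependent.iff_fractionRing k[X] (RatFunc k)).mp hu).fintype_card_le_finrank

lemma rank_quotX_le_finrank [Finite k] (M : Submodule k[X] F) :
    Module.rank k (QuotX M) ≤ Module.finrank (RatFunc k) F := by
  have := isTorsionFree_polynomial (k := k) (F := F)
  refine rank_quotX_le fun m u hu h => ?_
  simpa using card_le_finrank (linearIndependent_of_mod_X hu h)

lemma finite_quotX [Finite k] (M : Submodule k[X] F) : Finite (QuotX M) := by
  have : Module.Finite k (QuotX M) := by
    rw [← Module.rank_lt_aleph0_iff]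
    exact (rank_quotX_le_finrank M).trans_lt (Cardinal.natCast_lt_aleph0)
  exact Module.finite_of_finite k
end Quotient

section Approx
variable {k F : Type*} [Field k] [Field F]

lemma ValuationSubring.valuation_lt_one_of_inv_notMem {O : ValuationSubring F} {x : F}
    (h : x⁻¹ ∉ O) : O.valuation x < 1 := by
  have h1 : ¬ O.valuation x⁻¹ ≤ 1 := fun h' => h ((O.valuation_le_one_iff _).mp h')
  rw [map_inv₀, not_le] at h1
  rcases eq_or_ne (O.valuation x) 0 with h0 | h0
  · simp [h0]
  · exact (one_lt_inv₀ (zero_lt_iff.mpr h0)).mp h1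

variable {v : AbsoluteValue F ℝ} [Finite k] [Algebra k F] [Algebra k[X] F]
  [IsScalarTower k k[X] F] [Algebra (RatFunc k) F] [IsScalarTower k[X] (RatFunc k) F]
  [FiniteDimensional (RatFunc k) F]

lemma exists_approx (hv : IsNonarchimedean v) (hz : algebraMap k[X] F X ≠ 0)
    (hX : v (algebraMap k[X] F X) < 1) {W : Set (ValuationSubring F)}
    (hW : ∀ O ∈ W, algebraMap k[X] F X ∈ O) (hW' : ∀ O ∈ W, (algebraMap k[X] F X)⁻¹ ∉ O)
    (hnot : ∀ O ∈ W, ¬ unitBall v hv ≤ O) :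
    ∃ ε : F, v (1 - ε) < 1 ∧ ∀ O ∈ W, (algebraMap k[X] F X)⁻¹ * ε ∈ O := by
  classical
  have := isTorsionFree_polynomial (k := k) (F := F)
  have := isAlgebraic_polynomial (k := k) (F := F)
  set z := algebraMap k[X] F X with hzdef
  set M : Submodule k[X] F := Subalgebra.toSubmodule (integralClosure k[X] F) with hM
  have hMv : ∀ x ∈ M, v x ≤ 1 := fun x (hx : IsIntegral k[X] x) =>
    hx.mem_valuationSubring (O := unitBall v hv) (polynomial_mem_valuationSubring hX.le)
  have hMO : ∀ x ∈ M, ∀ O ∈ W, x ∈ O := fun x (hx : IsIntegral k[X] x) O hO =>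
    hx.mem_valuationSubring (polynomial_mem_valuationSubring (hW O hO))
  have := finite_quotX M
  have := Fintype.ofFinite (QuotX M)
  have hout : ∀ q : QuotX M, ∃ x : M, Submodule.Quotient.mk x = q :=
    Submodule.Quotient.mk_surjective _
  choose r hr using hout
  set e : integralClosure k[X] F := ∏ s : QuotX M, if v (r s) = 1 then (r s : integralClosure k[X] F) else 1 with he
  have hve : v e = 1 := by
    have : (e : F) = ∏ s : QuotX M, if v (r s) = 1 then (r s : F) else 1 := by
      rw [he, SubmonoidClass.coe_finsetProd]
      exact Finset.prod_congr rfl fun s _ => by split_ifs <;> rfl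
    rw [this, map_prod]
    refine Finset.prod_eq_one fun s _ => ?_
    split_ifs with h
    · exact h
    · simp
  have heO : ∀ O ∈ W, O.valuation (e : F) < 1 := by
    intro O hO
    obtain ⟨b, hb, hvb, hbO⟩ := exists_isIntegral_apply_eq_one hv hX (hnot O hO) (hW O hO)
    have h1 : (Submodule.Quotient.mk (r (Submodule.Quotient.mk ⟨b, hb⟩) - ⟨b, hb⟩) : QuotX M) = 0 := by
      rw [Submodule.Quotient.mk_sub, hr, sub_self]
    obtain ⟨m, hm, hrm⟩ := quotX_mk_eq_zero.mp h1
    set s : QuotX M := Submodule.Quotient.mk ⟨b, hb⟩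
    replace hrm : (r s : F) = b + z * m := by
      rw [← hzdef] at hrm
      rw [← hrm]; simp
    have hvr : v (r s) = 1 := by
      rw [hrm, hv.apply_add_eq_left, hvb]
      rw [hvb, map_mul]
      exact mul_lt_one_of_nonneg_of_lt_one_left (v.nonneg _) hX (hMv m hm)
    have hOr : O.valuation (r s : F) < 1 := by
      rw [hrm]
      refine (O.valuation.map_add _ _).trans_lt (max_lt (O.valuation_lt_one_of_inv_notMem hbO) ?_)
      rw [map_mul]
      exact mul_lt_one_of_lt_of_le (O.valuation_lt_one_of_inv_notMem (hW' O hO))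
        ((O.valuation_le_one_iff _).mpr (hMO m hm O hO))
    obtain ⟨e', he'⟩ : ∃ e' : integralClosure k[X] F, (e : F) = r s * e' :=
      ⟨_, by rw [he, ← Finset.mul_prod_erase _ _ (Finset.mem_univ s), if_pos hvr]; rfl⟩
    rw [he', map_mul]
    exact mul_lt_one_of_lt_of_le hOr ((O.valuation_le_one_iff _).mpr (hMO _ e'.2 O hO))
  obtain ⟨i, j, hij, hmk⟩ := Finite.exists_ne_map_eq_of_infinite
    fun n : ℕ => (Submodule.Quotient.mk (e ^ n : integralClosure k[X] F) : QuotX M)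
  wlog hlt : i < j generalizing i j
  · exact this j i hij.symm hmk.symm (by omega)
  obtain ⟨n, hn, rfl⟩ : ∃ n, 0 < n ∧ j = i + n := ⟨j - i, by omega, by omega⟩
  have h1 : (Submodule.Quotient.mk ((e ^ i : integralClosure k[X] F) - (e ^ (i + n) : integralClosure k[X] F) : M) : QuotX M) = 0 := by
    rw [Submodule.Quotient.mk_sub, sub_eq_zero]
    exact hmk
  obtain ⟨m, hm, hem⟩ := quotX_mk_eq_zero.mp h1
  replace hem : (e : F) ^ i * (1 - (e : F) ^ n) = z * m := by
    rw [← hem]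
    simp [pow_add, mul_sub]
  have hv1 : v (1 - (e : F) ^ n) < 1 := by
    have := congrArg v hem
    rw [map_mul, map_mul, map_pow, hve, one_pow, one_mul] at this
    rw [this]
    exact mul_lt_one_of_nonneg_of_lt_one_left (v.nonneg _) hX (hMv m hm)
  refine ⟨((e : F) ^ n) ^ (i + 1), ?_, fun O hO => ?_⟩
  · have hg := mul_neg_geom_sum ((e : F) ^ n) (i + 1)
    rw [← hg, map_mul]
    refine mul_lt_one_of_nonneg_of_lt_one_left (v.nonneg _) hv1 ?_
    change ∑ i ∈ Finset.range (i + 1), ((e : F) ^ n) ^ i ∈ unitBall v hv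
    exact sum_mem fun _ _ => pow_mem (pow_mem (by simp [hve]) _) _
  · have hu : O.valuation (1 - (e : F) ^ n) = 1 := by
      have : O.valuation ((e : F) ^ n) < 1 := by
        rw [map_pow]
        exact pow_lt_one₀ zero_le (heO O hO) hn.ne'
      exact O.valuation.map_one_sub_of_lt this
    have hne : (1 - (e : F) ^ n) ≠ 0 := by
      intro h0
      simp [h0] at hu
    have h2 : z⁻¹ * ((e : F) ^ n) ^ (i + 1) =
        m * (1 - (e : F) ^ n)⁻¹ * (e : F) ^ (n * (i + 1) - i) := by
      have h3 : i + (n * (i + 1) - i) = n * (i + 1) := by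
        have : i ≤ n * (i + 1) := by nlinarith
        omega
      rw [← pow_mul, ← h3, pow_add, h3, ← mul_assoc]
      congr 1
      rw [eq_mul_inv_iff_mul_eq₀ hne, mul_assoc, hem, inv_mul_cancel_left₀ hz]
    rw [h2]
    refine mul_mem (mul_mem (hMO m hm O hO) ?_) (pow_mem (hMO _ e.2 O hO) _)
    rw [← O.valuation_le_one_iff, map_inv₀, hu, inv_one]
end Approx

section Rank
variable {k F : Type*} [Field k] [Field F]
  {v : AbsoluteValue F ℝ} [Finite k] [Algebra k F] [Algebra k[X] F]
  [IsScalarTower k k[X] F]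

/-- The elements of `F` lying in all valuation rings of the set `W`. -/
def regularOn (W : Set (ValuationSubring F)) (hW : ∀ O ∈ W, algebraMap k[X] F X ∈ O) :
    Submodule k[X] F where
  carrier := {f | ∀ O ∈ W, f ∈ O}
  add_mem' ha hb O hO := add_mem (ha O hO) (hb O hO)
  zero_mem' O _ := O.zero_mem
  smul_mem' p f hf O hO := by
    rw [Algebra.smul_def]
    exact mul_mem (polynomial_mem_valuationSubring (hW O hO) p) (hf O hO)

variable [Algebra (RatFunc k) F] [IsScalarTower k[X] (RatFunc k) F]
  [FiniteDimensional (RatFunc k) F]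

lemma rank_quotX_regularOn_le (hv : IsNonarchimedean v) (hz : algebraMap k[X] F X ≠ 0)
    (hX : v (algebraMap k[X] F X) < 1) {W : Set (ValuationSubring F)}
    (hW : ∀ O ∈ W, algebraMap k[X] F X ∈ O) (hW' : ∀ O ∈ W, (algebraMap k[X] F X)⁻¹ ∉ O)
    (hnot : ∀ O ∈ W, ¬ unitBall v hv ≤ O) :
    Module.rank k (QuotX (regularOn W hW)) ≤ (Module.finrank (RatFunc k) F - 1 : ℕ) := by
  have := isTorsionFree_polynomial (k := k) (F := F)
  obtain ⟨ε, hε, hεW⟩ := exists_approx (k := k) hv hz hX hW hW' hnot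
  set z := algebraMap k[X] F X with hzdef
  refine rank_quotX_le fun m u hu hind => Nat.le_sub_of_add_le ?_
  have hvε : v ε = 1 := by
    have := hv.apply_add_eq_left (x := 1) (y := -(1 - ε)) (by rwa [v.map_neg, map_one])
    simpa using this
  have hεO : ∀ O ∈ W, ε ∈ O := fun O hO => by
    simpa [mul_inv_cancel_left₀ hz] using mul_mem (hW O hO) (hεW O hO)
  obtain ⟨N, hN⟩ : ∃ N : ℕ, ∀ i, v (u i * (1 - ε) ^ N) ≤ 1 := by
    have h1 : ∀ i, ∃ N : ℕ, v (u i) * v (1 - ε) ^ N ≤ 1 := by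
      intro i
      obtain ⟨N, hN⟩ := exists_pow_lt_of_lt_one (y := v (1 - ε)) (x := (v (u i) + 1)⁻¹)
        (by have := v.nonneg (u i); positivity) hε
      refine ⟨N, ?_⟩
      have h2 := mul_le_mul_of_nonneg_left hN.le (v.nonneg (u i))
      refine h2.trans ?_
      rw [← div_eq_mul_inv]
      exact div_le_one_of_le₀ (by linarith) (by linarith [v.nonneg (u i)])
    choose N hN using h1
    refine ⟨Finset.univ.sup N, fun i => ?_⟩
    rw [map_mul, map_pow]
    exact (mul_le_mul_of_nonneg_left (pow_le_pow_of_le_one (v.nonneg _) hε.le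
      (Finset.le_sup (Finset.mem_univ i))) (v.nonneg _)).trans (hN i)
  set g := ∑ j ∈ Finset.range N, (1 - ε) ^ j with hg
  have hgO : ∀ O ∈ W, g ∈ O := fun O hO =>
    sum_mem fun j _ => pow_mem (sub_mem (one_mem O) (hεO O hO)) j
  have hsub : ∀ i, u i = u i * (1 - ε) ^ N + z * (z⁻¹ * ε * g * u i) := by
    intro i
    have h1 : ε * g = 1 - (1 - ε) ^ N := by
      rw [hg, ← mul_neg_geom_sum, sub_sub_cancel]
    have h2 : z * (z⁻¹ * ε * g * u i) = (ε * g) * u i := by field_simp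
    rw [h2, h1]
    ring
  have hWv : ∀ O ∈ insert (unitBall v hv) W, z ∈ O := by
    rintro O (rfl | hO)
    · exact hX.le
    · exact hW O hO
  have hli : LinearIndependent k[X]
      (fun o : Option (Fin m) => o.elim ε fun i => u i * (1 - ε) ^ N) := by
    refine linearIndependent_of_mod_X (M := regularOn _ hWv) ?_ ?_
    · rintro (_ | i) O (rfl | hO)
      · exact hvε.le
      · exact hεO O hO
      · exact hN i
      · exact mul_mem (hu i O hO) (pow_mem (sub_mem (one_mem O) (hεO O hO)) N)
    · rintro c ⟨y, hy, hcy⟩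
      rw [Fintype.sum_option] at hcy
      simp only [Option.elim_none, Option.elim_some] at hcy
      rw [← hzdef] at hcy
      have hsome : ∀ i, c (some i) = 0 := by
        refine hind (fun i => c (some i)) ⟨y - algebraMap k F (c none) * (z⁻¹ * ε) +
          ∑ i, algebraMap k F (c (some i)) * (z⁻¹ * ε * g * u i), fun O hO => ?_, ?_⟩
        · refine add_mem (sub_mem (hy O (.inr hO)) (mul_mem (algebraMap_mem_valuationSubring O _)
            (hεW O hO))) (sum_mem fun i _ => mul_mem (algebraMap_mem_valuationSubring O _)
            (mul_mem (mul_mem (hεW O hO) (hgO O hO)) (hu i O hO)))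
        · rw [← hzdef, mul_add, mul_sub, ← hcy, Finset.mul_sum]
          have h3 : z * (algebraMap k F (c none) * (z⁻¹ * ε)) = algebraMap k F (c none) * ε := by
            field_simp
          rw [h3, add_sub_cancel_left, ← Finset.sum_add_distrib]
          refine Finset.sum_congr rfl fun i _ => ?_
          conv_lhs => rw [hsub i]
          ring
      rintro (_ | i)
      · by_contra h0
        simp only [hsome, map_zero, zero_mul, Finset.sum_const_zero, add_zero] at hcy
        have h4 := congrArg v hcy
        rw [map_mul, hv.apply_algebraMap_eq_one h0, hvε, map_mul, one_mul] at h4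
        exact absurd h4.symm (mul_lt_one_of_nonneg_of_lt_one_left (v.nonneg _) hX
          (hy _ (.inl rfl))).ne
      · exact hsome i
  simpa using card_le_finrank hli

/-- A Riemann-Roch type estimate. -/
lemma finrank_le_of_pow_mul_mem {M : Submodule k[X] F} {q : ℕ}
    (hM : Module.rank k (QuotX M) ≤ q) (n : ℕ) (P : Submodule k F) [Module.Finite k P]
    (hP : ∀ f ∈ P, algebraMap k[X] F X ^ n * f ∈ M) (hz : algebraMap k[X] F X ≠ 0) :
    Module.finrank k P ≤ Module.finrank k ↥(P ⊓ M.restrictScalars k) + n * q := by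
  induction n generalizing P with
  | zero =>
    have : P ⊓ M.restrictScalars k = P := inf_eq_left.mpr fun f hf => by simpa using hP f hf
    rw [this, zero_mul, add_zero]
  | succ n ih =>
    have hfin : Module.Finite k (QuotX M) :=
      Module.rank_lt_aleph0_iff.mp (hM.trans_lt Cardinal.natCast_lt_aleph0)
    let φ : P →ₗ[k] QuotX M :=
      (Submodule.mkQ _).restrictScalars k ∘ₗ
        LinearMap.codRestrict (M.restrictScalars k)
          ((LinearMap.mulLeft k (algebraMap k[X] F X ^ (n + 1))) ∘ₗ P.subtype)
          (fun f => hP f f.2)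
    have hker : ∀ f : P, φ f = 0 → algebraMap k[X] F X ^ n * (f : F) ∈ M := by
      intro f hf
      obtain ⟨m, hm, h⟩ := quotX_mk_eq_zero.mp hf
      change algebraMap k[X] F X ^ (n + 1) * (f : F) = _ at h
      rw [pow_succ', mul_assoc] at h
      rwa [mul_left_cancel₀ hz h]
    have h1 := φ.finrank_range_add_finrank_ker
    have h2 : Module.finrank k (LinearMap.range φ) ≤ q :=
      (Submodule.finrank_le _).trans (by
        rw [← Nat.cast_le (α := Cardinal), Module.finrank_eq_rank]; exact hM)
    have h3 := ih ((LinearMap.ker φ).map P.subtype) (by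
      rintro _ ⟨f, hf, rfl⟩
      exact hker f hf)
    rw [Submodule.finrank_map_subtype_eq] at h3
    have h4 : Module.finrank k ↥((LinearMap.ker φ).map P.subtype ⊓ M.restrictScalars k) ≤
        Module.finrank k ↥(P ⊓ M.restrictScalars k) := by
      have : Module.Finite k ↥(P ⊓ M.restrictScalars k) :=
        Submodule.finiteDimensional_of_le inf_le_left
      exact Submodule.finrank_mono (inf_le_inf_right _ (Submodule.map_subtype_le _ _))
    rw [add_mul, one_mul]
    omega
end Rank

section Pole
variable {k F : Type*} [Field k] [Field F] {v : AbsoluteValue F ℝ}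

lemma not_unitBall_le (hv : IsNonarchimedean v) {O : ValuationSubring F} {y : F} (hy : y ∉ O)
    (hO : (O : Set F) ≠ {y | v y ≤ 1}) : ¬ unitBall v hv ≤ O := by
  intro hle
  obtain ⟨g, hg, hvg⟩ : ∃ g ∈ O, 1 < v g := by
    by_contra! h
    exact hO (Set.Subset.antisymm h hle)
  obtain ⟨n, hn⟩ := pow_unbounded_of_one_lt (v y) hvg
  refine hy ?_
  have hg0 : g ≠ 0 := by
    rintro rfl
    simp at hvg
    linarith
  have h1 : y * (g ^ n)⁻¹ ∈ O := hle <| by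
    rw [mem_unitBall, map_mul, map_inv₀, map_pow, ← div_eq_mul_inv]
    exact div_le_one_of_le₀ hn.le (by positivity)
  simpa [hg0] using mul_mem h1 (pow_mem hg n)

variable [Finite k] [Algebra k F] [Algebra k[X] F]
  [IsScalarTower k k[X] F] [Algebra (RatFunc k) F] [IsScalarTower k[X] (RatFunc k) F]
  [FiniteDimensional (RatFunc k) F]

/-- A place of a global function field admits a nonconstant function regular outside it. -/
lemma exists_one_lt_forall_mem (hv : IsNonarchimedean v) (hz : algebraMap k[X] F X ≠ 0)
    (hX : v (algebraMap k[X] F X) < 1) :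
    ∃ x : F, 1 < v x ∧ ∀ O : ValuationSubring F, (O : Set F) ≠ {y | v y ≤ 1} → x ∈ O := by
  classical
  set z := algebraMap k[X] F X with hzdef
  set W : Set (ValuationSubring F) := {O | z⁻¹ ∉ O ∧ (O : Set F) ≠ {y | v y ≤ 1}} with hWdef
  rcases W.eq_empty_or_nonempty with hWe | ⟨O', hO'⟩
  · refine ⟨z⁻¹, ?_, fun O hO => ?_⟩
    · rw [map_inv₀]
      exact (one_lt_inv₀ (v.pos hz)).mpr hX
    · by_contra h
      exact (hWe ▸ (⟨h, hO⟩ : O ∈ W) : O ∈ (∅ : Set (ValuationSubring F)))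
  have hW : ∀ O ∈ W, z ∈ O := fun O hO => by
    simpa [hO.1] using O.mem_or_inv_mem z
  have hrank := rank_quotX_regularOn_le (k := k) hv hz hX hW (fun O hO => hO.1)
    (fun O hO => not_unitBall_le hv hO.1 hO.2)
  obtain ⟨s, b, hb⟩ := FiniteDimensional.exists_is_basis_integral k[X] (RatFunc k) F
  have hcard : Module.finrank (RatFunc k) F = Fintype.card s := Module.finrank_eq_card_basis b
  have hd : 0 < Module.finrank (RatFunc k) F := Module.finrank_pos
  set d := Module.finrank (RatFunc k) F with hd'
  choose κ hκ using fun i => (hb i).exists_inv_pow_mul_mem (k := k) hz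
  set K := Finset.univ.sup κ with hK
  have hκK : ∀ i, ∀ O : ValuationSubring F, z⁻¹ ∈ O → z⁻¹ ^ K * b i ∈ O := by
    intro i O hO
    obtain ⟨j, hj⟩ := Nat.exists_eq_add_of_le (Finset.le_sup (f := κ) (Finset.mem_univ i))
    rw [hK, hj, pow_add, mul_assoc, mul_left_comm]
    exact mul_mem (pow_mem hO j) (hκ i O hO)
  set m := (K + 1) * (d - 1) with hm
  have hli : LinearIndependent k fun p : Fin (m + 1) × s =>
      z⁻¹ ^ (m + K + 1) * (z ^ (p.1 : ℕ) * b p.2) := by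
    have h1 : LinearIndependent k fun j : Fin (m + 1) => (X : k[X]) ^ (j : ℕ) := by
      have := (basisMonomials k).linearIndependent.comp (fun j : Fin (m + 1) => (j : ℕ))
        Fin.val_injective
      convert this using 2 with j
      simp [X_pow_eq_monomial]
    have h2 : LinearIndependent k[X] b :=
      (LinearIndependent.iff_fractionRing k[X] (RatFunc k)).mpr b.linearIndependent
    have h3 := (linearIndependent_smul h1 h2).map' (LinearMap.mulLeft k (z⁻¹ ^ (m + K + 1)))
      (LinearMap.ker_eq_bot.mpr fun x y h =>
        mul_left_cancel₀ (pow_ne_zero _ (inv_ne_zero hz)) h)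
    have h4 : (fun p : Fin (m + 1) × s => z⁻¹ ^ (m + K + 1) * (z ^ (p.1 : ℕ) * b p.2)) =
        LinearMap.mulLeft k (z⁻¹ ^ (m + K + 1)) ∘
          fun p : Fin (m + 1) × s => (X : k[X]) ^ (p.1 : ℕ) • b p.2 := by
      funext p
      simp [Algebra.smul_def, hzdef]
    rw [h4]
    exact h3
  set w := fun p : Fin (m + 1) × s => z⁻¹ ^ (m + K + 1) * (z ^ (p.1 : ℕ) * b p.2) with hw
  set P := Submodule.span k (Set.range w) with hP
  have hPfin : Module.Finite k P := Module.Finite.span_of_finite k (Set.finite_range w)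
  have hPrank : Module.finrank k P = (m + 1) * d := by
    rw [hP, finrank_span_eq_card hli, hcard]
    simp
  have hP1 : ∀ f ∈ P, z ^ (m + K + 1) * f ∈ regularOn W hW := by
    intro f hf O hO
    induction hf using Submodule.span_induction with
    | mem x hx =>
      obtain ⟨p, rfl⟩ := hx
      have : z ^ (m + K + 1) * w p = z ^ (p.1 : ℕ) * b p.2 := by
        simp only [hw, inv_pow]
        exact mul_inv_cancel_left₀ (pow_ne_zero _ hz) _
      rw [this]
      exact mul_mem (pow_mem (hW O hO) _)
        ((hb p.2).mem_valuationSubring (polynomial_mem_valuationSubring (hW O hO)))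
    | zero => simp
    | add x y _ _ hx hy => rw [mul_add]; exact add_mem hx hy
    | smul a x _ hx =>
      rw [Algebra.smul_def, mul_left_comm]
      exact mul_mem (algebraMap_mem_valuationSubring O a) hx
  have hP2 : ∀ f ∈ P, ∀ O : ValuationSubring F, z⁻¹ ∈ O → z * f ∈ O := by
    intro f hf O hO
    induction hf using Submodule.span_induction with
    | mem x hx =>
      obtain ⟨p, rfl⟩ := hx
      obtain ⟨j, hj⟩ := Nat.exists_eq_add_of_le (Nat.lt_succ_iff.mp p.1.2)
      have : z * w p = z⁻¹ ^ j * (z⁻¹ ^ K * b p.2) := by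
        have h4 : m + K + 1 = p.1 + j + K + 1 := by omega
        simp only [hw, inv_pow, h4]
        field_simp
        ring
      rw [this]
      exact mul_mem (pow_mem hO _) (hκK _ O hO)
    | zero => simp
    | add x y _ _ hx hy => rw [mul_add]; exact add_mem hx hy
    | smul a x _ hx =>
      rw [Algebra.smul_def, mul_left_comm]
      exact mul_mem (algebraMap_mem_valuationSubring O a) hx
  have hle := finrank_le_of_pow_mul_mem hrank (m + K + 1) P hP1 hz
  have hpos : 0 < Module.finrank k ↥(P ⊓ (regularOn W hW).restrictScalars k) := by
    rw [hPrank] at hle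
    obtain ⟨q, hq⟩ : ∃ q, d = q + 1 := ⟨d - 1, by omega⟩
    rw [hq, Nat.add_sub_cancel] at hle hm
    by_contra h
    nlinarith
  have hne : P ⊓ (regularOn W hW).restrictScalars k ≠ ⊥ := by
    intro h
    rw [h, finrank_bot] at hpos
    exact hpos.false
  obtain ⟨f, ⟨hfP, hfW⟩, hf0⟩ := Submodule.exists_mem_ne_zero_of_ne_bot hne
  have hmem : ∀ O : ValuationSubring F, (O : Set F) ≠ {y | v y ≤ 1} → z * f ∈ O := by
    intro O hO
    by_cases h : z⁻¹ ∈ O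
    · exact hP2 f hfP O h
    · exact mul_mem (hW O ⟨h, hO⟩) (hfW O ⟨h, hO⟩)
  refine ⟨z * f, ?_, hmem⟩
  by_contra! hle1
  have hint : IsIntegral k (z * f) := isIntegral_of_forall_mem_valuationSubring fun O _ => by
    by_cases hO : (O : Set F) = {y | v y ≤ 1}
    · have : z * f ∈ (O : Set F) := hO ▸ hle1
      exact this
    · exact hmem O hO
  have hinv : (z * f)⁻¹ ∈ O' := hint.inv.mem_valuationSubring (algebraMap_mem_valuationSubring O')
  refine hO'.1 ?_
  have := mul_mem hinv (hfW O' hO')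
  rwa [mul_inv, mul_assoc, inv_mul_cancel₀ hf0, mul_one] at this
end Pole

section ChangeOfVariable
open scoped IntermediateField
variable {k F : Type*} [Field k] [Field F] [Algebra k F]

lemma exists_algebra_of_transcendental {y : F} (hy : Transcendental k y)
    [FiniteDimensional k⟮y⟯ F] :
    ∃ (_ : Algebra k[X] F) (_ : Algebra (RatFunc k) F), IsScalarTower k k[X] F ∧
      IsScalarTower k[X] (RatFunc k) F ∧ FiniteDimensional (RatFunc k) F ∧
      algebraMap k[X] F X = y := by
  let e := RatFunc.algEquivOfTranscendental y hy
  let : Algebra k[X] F := (aeval y).toAlgebra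
  let : Algebra (RatFunc k) F :=
    ((algebraMap k⟮y⟯ F).comp (e : RatFunc k →+* k⟮y⟯)).toAlgebra
  refine ⟨inferInstance, inferInstance, ?_, ?_, ?_, ?_⟩
  · exact .of_algebraMap_eq fun r => ((aeval y).commutes r).symm
  · refine .of_algebraMap_eq fun p => ?_
    change aeval y p = ((e (algebraMap k[X] (RatFunc k) p) : k⟮y⟯) : F)
    rw [RatFunc.algEquivOfTranscendental_algebraMap]
    exact (aeval_algebraMap_apply F (IntermediateField.AdjoinSimple.gen k y) p)
  · refine Module.Finite.of_equiv_equiv (A₁ := k⟮y⟯) (B₁ := F) e.symm.toRingEquiv (RingEquiv.refl F) ?_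
    ext x
    change ((e (e.symm x) : k⟮y⟯) : F) = x
    rw [e.apply_symm_apply]
  · exact aeval_X y

variable {v : AbsoluteValue F ℝ} [Finite k]

lemma transcendental_of_one_lt (hv : IsNonarchimedean v) {y : F} (hy : 1 < v y) :
    Transcendental k y := fun h =>
  hy.not_ge (IsIntegral.mem_valuationSubring (O := unitBall v hv)
    (algebraMap_mem_valuationSubring (k := k) _) h.isIntegral)

variable [Algebra (RatFunc k) F] [IsScalarTower k (RatFunc k) F] [FiniteDimensional (RatFunc k) F]

lemma exists_algebra_of_one_lt (hv : IsNonarchimedean v) {y : F} (hy : 1 < v y ∨ 1 < v y⁻¹) :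
    ∃ (_ : Algebra k[X] F) (_ : Algebra (RatFunc k) F), IsScalarTower k k[X] F ∧
      IsScalarTower k[X] (RatFunc k) F ∧ FiniteDimensional (RatFunc k) F ∧
      algebraMap k[X] F X = y := by
  have hyt : Transcendental k y := by
    rcases hy with hy | hy
    · exact transcendental_of_one_lt hv hy
    · exact fun h => transcendental_of_one_lt (k := k) hv hy h.inv
  have := FunctionField.finiteDimensional_of_adjoin_transcendental hyt
  exact exists_algebra_of_transcendental hyt

end ChangeOfVariable

section Integral
variable {k F : Type*} [Field k] [Field F]
  {v : AbsoluteValue F ℝ} [Finite k] [Algebra k F] [Algebra k[X] F]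
  [IsScalarTower k k[X] F]

lemma apply_algebraMap_eq_pow (hv : IsNonarchimedean v) (hX : 1 < v (algebraMap k[X] F X)) {p : k[X]}
    (hp : p ≠ 0) : v (algebraMap k[X] F p) = v (algebraMap k[X] F X) ^ p.natDegree := by
  induction h : p.natDegree generalizing p with
  | zero =>
    rw [eq_C_of_natDegree_eq_zero h] at hp ⊢
    rw [algebraMap_C, hv.apply_algebraMap_eq_one (by simpa using hp), pow_zero]
  | succ n ih =>
    have h1 : p.divX.natDegree = n := by
      rw [natDegree_divX_eq_natDegree_tsub_one, h, Nat.add_sub_cancel]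
    have h2 : p.divX ≠ 0 := by
      intro h0
      rw [divX_eq_zero_iff] at h0
      rw [h0, natDegree_C] at h
      omega
    have h3 : v (algebraMap k[X] F p.divX * algebraMap k[X] F X) =
        v (algebraMap k[X] F X) ^ (n + 1) := by
      rw [map_mul, ih h2 h1, pow_succ]
    rw [algebraMap_eq_divX, hv.apply_add_eq_left, h3]
    rw [h3]
    exact (algebraMap_mem_valuationSubring (unitBall v hv) (p.coeff 0)).trans_lt
      (one_lt_pow₀ hX (by omega))

variable [Algebra (RatFunc k) F] [IsScalarTower k[X] (RatFunc k) F]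
  [FiniteDimensional (RatFunc k) F]

lemma exists_isIntegral_apply_sub_le (hv : IsNonarchimedean v) (hX : 1 < v (algebraMap k[X] F X)) :
    ∃ R : ℝ, ∀ f : F, ∃ a : F, IsIntegral k[X] a ∧ v (f - a) ≤ R := by
  obtain ⟨s, b, hb⟩ := FiniteDimensional.exists_is_basis_integral k[X] (RatFunc k) F
  refine ⟨∑ i, v (b i), fun f => ?_⟩
  refine ⟨∑ i, algebraMap k[X] F ((b.repr f i).num / (b.repr f i).denom) * b i,
    IsIntegral.sum _ fun i _ => isIntegral_algebraMap.mul (hb i), ?_⟩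
  conv_lhs => rw [← b.sum_repr f, ← Finset.sum_sub_distrib]
  refine (v.sum_le _ _).trans (Finset.sum_le_sum fun i _ => ?_)
  rw [b.sum_repr f]
  set r := b.repr f i
  rw [Algebra.smul_def, ← sub_mul, map_mul]
  refine mul_le_of_le_one_left (v.nonneg _) ?_
  have hd : r.denom ≠ 0 := r.denom_ne_zero
  have hd' : algebraMap k[X] F r.denom ≠ 0 := fun h => by
    have := apply_algebraMap_eq_pow hv hX hd
    rw [h, map_zero] at this
    exact absurd this.symm (pow_ne_zero _ (by linarith))
  have h1 : algebraMap (RatFunc k) F r - algebraMap k[X] F (r.num / r.denom) =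
      algebraMap k[X] F (r.num % r.denom) / algebraMap k[X] F r.denom := by
    rw [eq_div_iff hd', sub_mul, ← map_mul]
    nth_rewrite 1 [← r.num_div_denom]
    rw [map_div₀, ← IsScalarTower.algebraMap_apply, ← IsScalarTower.algebraMap_apply,
      div_mul_cancel₀ _ hd', ← map_sub]
    congr 1
    rw [sub_eq_iff_eq_add, add_comm, mul_comm]
    exact (EuclideanDomain.div_add_mod _ _).symm
  rw [h1, map_div₀]
  refine div_le_one_of_le₀ ?_ (v.nonneg _)
  by_cases h0 : r.num % r.denom = 0
  · rw [h0, map_zero, map_zero]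
    exact v.nonneg _
  · rw [apply_algebraMap_eq_pow hv hX h0, apply_algebraMap_eq_pow hv hX hd]
    exact pow_le_pow_right₀ hX.le (natDegree_le_natDegree (degree_mod_lt _ hd).le)

lemma exists_isIntegral_mul_eq (f : F) :
    ∃ b : F, b ≠ 0 ∧ IsIntegral k[X] b ∧ IsIntegral k[X] (b * f) := by
  have := isTorsionFree_polynomial (k := k) (F := F)
  have := isAlgebraic_polynomial (k := k) (F := F)
  obtain ⟨y, hy0, hy⟩ := (Algebra.IsAlgebraic.isAlgebraic (R := k[X]) f).exists_integral_multiple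
  refine ⟨algebraMap k[X] F y, ?_, isIntegral_algebraMap, by rwa [← Algebra.smul_def]⟩
  simpa using hy0
end Integral

/-- The ring `A` of functions regular outside a place is large: `F` is its fraction field, and every
element of `F` is at bounded distance from `A`. -/
lemma regular_outside_place {k F : Type*} [Field k] [Finite k] [Field F]
    [Algebra (RatFunc k) F] [FiniteDimensional (RatFunc k) F] {v : AbsoluteValue F ℝ}
    (hv : IsNonarchimedean v) {π : F} (hπ0 : π ≠ 0) (hπ : v π < 1) {A : Subring F}
    (hA : ∀ x : F, (∀ O : ValuationSubring F,
      (O : Set F) ≠ Set.univ → (O : Set F) ≠ {y : F | v y ≤ 1} → x ∈ O) → x ∈ A) :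
    (∀ f : F, ∃ b ∈ A, b ≠ 0 ∧ b * f ∈ A) ∧ ∃ R : ℝ, ∀ f : F, ∃ a ∈ A, v (f - a) ≤ R := by
  let : Algebra k F := ((algebraMap (RatFunc k) F).comp (algebraMap k (RatFunc k))).toAlgebra
  have : IsScalarTower k (RatFunc k) F := .of_algebraMap_eq fun _ => rfl
  obtain ⟨x, hx, hxO⟩ : ∃ x : F, 1 < v x ∧
      ∀ O : ValuationSubring F, (O : Set F) ≠ {y | v y ≤ 1} → x ∈ O := by
    obtain ⟨_, i2, _, _, _, hπX⟩ := exists_algebra_of_one_lt (k := k) hv (y := π)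
      (.inr (by rw [map_inv₀]; exact (one_lt_inv₀ (v.pos hπ0)).mpr hπ))
    subst hπX
    exact exists_one_lt_forall_mem (k := k) hv hπ0 hπ
  obtain ⟨_, i2, _, _, _, hxX⟩ := exists_algebra_of_one_lt (k := k) hv (y := x) (.inl hx)
  subst hxX
  have hint : ∀ a : F, IsIntegral k[X] a → a ∈ A := fun a ha => hA a fun O _ hO =>
    ha.mem_valuationSubring (polynomial_mem_valuationSubring (hxO O hO))
  refine ⟨fun f => ?_, ?_⟩
  · obtain ⟨b, hb0, hb, hbf⟩ := exists_isIntegral_mul_eq (k := k) f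
    exact ⟨b, hint _ hb, hb0, hint _ hbf⟩
  · obtain ⟨R, hR⟩ := exists_isIntegral_apply_sub_le (k := k) hv hx
    exact ⟨R, fun f => let ⟨a, ha, h⟩ := hR f; ⟨a, hint _ ha, h⟩⟩

end FunctionField

section Extension

/-- An ultrametric function on a dense subset extends uniquely. -/
lemma existsUnique_ultrametric_extension {V I : Type*} [AddCommGroup V] {u : I → V} {ν : I → ℝ}
    {T : V → ℝ} (hν : ∀ i, 0 ≤ ν i) (hTu : ∀ w w', T (w + w') ≤ max (T w) (T w'))
    (hTn : ∀ w, T (-w) = T w) (hcompat : ∀ i j, ν i ≤ max (ν j) (T (u i - u j)))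
    (hdense : ∀ w, ∀ δ > 0, ∃ i, T (w - u i) < δ) (w : V) :
    ∃! r : ℝ, 0 ≤ r ∧ ∀ i, ν i ≤ max r (T (w - u i)) ∧ r ≤ max (ν i) (T (w - u i)) := by
  have : Nonempty I := ⟨(hdense w 1 one_pos).choose⟩
  have hbdd : BddBelow (Set.range fun i => max (ν i) (T (w - u i))) :=
    ⟨0, by rintro _ ⟨i, rfl⟩; exact le_max_of_le_left (hν i)⟩
  have h0 : 0 ≤ (⨅ i, max (ν i) (T (w - u i))) ∧ ∀ i,
      ν i ≤ max (⨅ i, max (ν i) (T (w - u i))) (T (w - u i)) ∧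
        (⨅ i, max (ν i) (T (w - u i))) ≤ max (ν i) (T (w - u i)) := by
    refine ⟨le_ciInf fun i => le_max_of_le_left (hν i), fun i => ⟨?_, ciInf_le hbdd i⟩⟩
    by_contra! h
    rw [max_lt_iff] at h
    obtain ⟨j, hj⟩ := exists_lt_of_ciInf_lt h.1
    rw [max_lt_iff] at hj
    have h1 : T (u i - u j) ≤ max (T (w - u i)) (T (w - u j)) := by
      have := hTu (-(w - u i)) (w - u j)
      rwa [hTn, neg_sub, sub_add_sub_cancel] at this
    exact absurd (hcompat i j) (not_le.mpr (max_lt hj.1 (h1.trans_lt (max_lt h.2 hj.2))))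
  have aux : ∀ r r' : ℝ,
      (0 ≤ r ∧ ∀ i, ν i ≤ max r (T (w - u i)) ∧ r ≤ max (ν i) (T (w - u i))) →
      (0 ≤ r' ∧ ∀ i, ν i ≤ max r' (T (w - u i)) ∧ r' ≤ max (ν i) (T (w - u i))) → r' ≤ r := by
    intro r r' hr hr'
    by_contra! hlt
    obtain ⟨i, hi⟩ := hdense w r' (hr.1.trans_lt hlt)
    have h1 := (le_max_iff.mp (hr'.2 i).2).resolve_right (not_le.mpr hi)
    exact absurd (h1.trans (hr.2 i).1) (not_le.mpr (max_lt hlt hi))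
  exact ⟨_, h0, fun r hr => le_antisymm (aux _ _ h0 hr) (aux _ _ hr h0)⟩

theorem existsUnique_norm_extension {F E V Λ : Type*} [Field F] [Field E] [Algebra F E]
    [AddCommGroup V] [Module E V] {v : AbsoluteValue F ℝ} {e : AbsoluteValue E ℝ}
    (hext : ∀ x : F, e (algebraMap F E x) = v x)
    (hdense : ∀ (y : E) (δ : ℝ), 0 < δ → ∃ x : F, e (y - algebraMap F E x) < δ)
    (he : IsNonarchimedean e) {A : Subring F} (hfrac : ∀ f : F, ∃ b ∈ A, b ≠ 0 ∧ b * f ∈ A)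
    (hunb : ∀ C : ℝ, ∃ b ∈ A, C < v b) [AddCommGroup Λ] [Module A Λ] {N : Λ → ℝ}
    (hN0 : ∀ l, 0 ≤ N l) (hNz : ∀ l, N l = 0 ↔ l = 0) (hNu : ∀ l l', N (l + l') ≤ max (N l) (N l'))
    (hNs : ∀ (a : A) (l : Λ), N (a • l) = v (a : F) * N l)
    (hdiscrete : ∀ r : ℝ, 0 < r → {l : Λ | N l ≤ r}.Finite)
    {j : Λ →+ V} (hj : ∀ (a : A) l, j (a • l) = algebraMap F E a • j l)
    {T : V → ℝ} (hT0 : ∀ w, 0 ≤ T w) (hTz : ∀ w, T w = 0 → w = 0)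
    (hTu : ∀ w w', T (w + w') ≤ max (T w) (T w')) (hTs : ∀ (x : E) w, T (x • w) = e x * T w)
    (hNT : ∀ l, N l ≤ T (j l)) (hR : ∃ R : ℝ, ∀ w, ∃ l, T (w - j l) ≤ R)
    (hdom : ∀ G : V → ℝ, (∀ w w', G (w + w') ≤ max (G w) (G w')) →
      (∀ (x : E) w, G (x • w) = e x * G w) → (∀ l, G (j l) = N l) → ∀ w, G w ≤ T w) :
    ∃! Ninf : V → ℝ,
      (∀ w, 0 ≤ Ninf w) ∧
      (∀ w, Ninf w = 0 ↔ w = 0) ∧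
      (∀ w w', Ninf (w + w') ≤ max (Ninf w) (Ninf w')) ∧
      (∀ (x : E) w, Ninf (x • w) = e x * Ninf w) ∧
      (∀ l : Λ, Ninf (j l) = N l) := by
  obtain ⟨R, hR⟩ := hR
  let I := {b : A // b ≠ 0} × Λ
  let u : I → V := fun i => (algebraMap F E i.1.1)⁻¹ • j i.2
  let ν : I → ℝ := fun i => (v (i.1.1 : F))⁻¹ * N i.2
  have hb0 : ∀ b : {b : A // b ≠ 0}, 0 < v (b.1 : F) := fun b =>
    v.pos (by simpa using b.2)
  have hbE : ∀ b : {b : A // b ≠ 0}, algebraMap F E b.1 ≠ 0 := fun b => by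
    simpa using b.2
  have hν : ∀ i, 0 ≤ ν i := fun i => mul_nonneg (inv_nonneg.mpr (v.nonneg _)) (hN0 _)
  have hTn : ∀ w, T (-w) = T w := fun w => by
    rw [← neg_one_smul E w, hTs, e.map_neg, map_one, one_mul]
  have hcompat : ∀ i i', ν i ≤ max (ν i') (T (u i - u i')) := by
    rintro ⟨b, l⟩ ⟨b', l'⟩
    have h1 := hNu (b.1 • l') (b'.1 • l - b.1 • l')
    rw [add_sub_cancel, hNs, hNs] at h1
    have h2 := hNT (b'.1 • l - b.1 • l')
    have h3 : u (b, l) - u (b', l') =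
        (algebraMap F E b.1 * algebraMap F E b'.1)⁻¹ • j (b'.1 • l - b.1 • l') := by
      have hb := hbE b
      have hb' := hbE b'
      simp only [u]
      rw [map_sub, hj, hj, smul_sub, smul_smul, smul_smul]
      congr 2 <;> field_simp
    rw [h3, hTs, map_inv₀, map_mul, hext, hext]
    have hp := hb0 b
    have hp' := hb0 b'
    have h4 : ν (b, l) = (v (b.1 : F) * v (b'.1 : F))⁻¹ * (v (b'.1 : F) * N l) := by
      simp only [ν]; field_simp
    have h5 : ν (b', l') = (v (b.1 : F) * v (b'.1 : F))⁻¹ * (v (b.1 : F) * N l') := by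
      simp only [ν]; field_simp
    rw [h4, h5, ← mul_max_of_nonneg _ _ (by positivity)]
    exact mul_le_mul_of_nonneg_left (h1.trans (max_le_max le_rfl h2)) (by positivity)
  have hdenseT : ∀ w, ∀ δ > 0, ∃ i, T (w - u i) < δ := by
    intro w δ hδ
    obtain ⟨b, hbA, hb⟩ := hunb (max (R / δ) 0)
    rw [max_lt_iff] at hb
    have hbne : b ≠ 0 := v.pos_iff.mp hb.2
    obtain ⟨l, hl⟩ := hR (algebraMap F E b • w)
    have hbE' : algebraMap F E b ≠ 0 := by simpa using hbne
    refine ⟨(⟨⟨b, hbA⟩, fun h => hbne (congrArg Subtype.val h)⟩, l), ?_⟩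
    have h1 : w - u (⟨⟨b, hbA⟩, fun h => hbne (congrArg Subtype.val h)⟩, l) =
        (algebraMap F E b)⁻¹ • (algebraMap F E b • w - j l) := by
      rw [smul_sub, inv_smul_smul₀ hbE']
    rw [h1, hTs, map_inv₀, hext, inv_mul_lt_iff₀ hb.2]
    rw [div_lt_iff₀ hδ] at hb
    exact hl.trans_lt hb.1
  have hex := existsUnique_ultrametric_extension hν hTu hTn hcompat hdenseT
  choose Ninf hNinf huniq using hex
  replace huniq : ∀ w r, (0 ≤ r ∧ ∀ i, ν i ≤ max r (T (w - u i)) ∧ r ≤ max (ν i) (T (w - u i))) →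
      r = Ninf w := huniq
  have hupper : ∀ w i, Ninf w ≤ max (ν i) (T (w - u i)) := fun w i => ((hNinf w).2 i).2
  have hlower : ∀ w i, ν i ≤ max (Ninf w) (T (w - u i)) := fun w i => ((hNinf w).2 i).1
  let one : {b : A // b ≠ 0} := ⟨1, by
    intro h
    exact one_ne_zero (congrArg Subtype.val h)⟩
  have hu1 : ∀ l, u (one, l) = j l := fun l => by simp [u, one]
  have hν1 : ∀ l, ν (one, l) = N l := fun l => by simp [ν, one]
  have hTzero : T 0 = 0 := by simpa using hTs 0 0
  have hTsub : ∀ w w', T (w - w') ≤ max (T w) (T w') := fun w w' => by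
    rw [sub_eq_add_neg, ← hTn w']
    exact hTu _ _
  have hrestr : ∀ l, Ninf (j l) = N l := by
    intro l
    refine (huniq _ _ ⟨hN0 l, fun i => ?_⟩).symm
    rw [← hu1, ← hν1]
    refine ⟨?_, hcompat _ _⟩
    rw [← hTn, neg_sub]
    exact hcompat _ _
  have hultra : ∀ w w', Ninf (w + w') ≤ max (Ninf w) (Ninf w') := by
    intro w w'
    by_contra! h
    rw [max_lt_iff] at h
    have hpos := (hNinf w).1.trans_lt h.1
    obtain ⟨⟨b, l⟩, hi⟩ := hdenseT w _ hpos
    obtain ⟨⟨b', l'⟩, hi'⟩ := hdenseT w' _ hpos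
    have hlt := (hlower w (b, l)).trans_lt (max_lt h.1 hi)
    have hlt' := (hlower w' (b', l')).trans_lt (max_lt h.2 hi')
    have hp := hb0 b
    have hp' := hb0 b'
    have hb := hbE b
    have hb' := hbE b'
    let m : I := (⟨b.1 * b'.1, by
      intro h0
      have := congrArg (fun a : A => algebraMap F E a) h0
      simp [hb, hb'] at this⟩, b'.1 • l + b.1 • l')
    have hum : u m = u (b, l) + u (b', l') := by
      simp only [u, m]
      rw [map_add, hj, hj, smul_add, smul_smul, smul_smul]
      congr 2 <;> (push_cast; field_simp)
    have hνm : ν m ≤ max (ν (b, l)) (ν (b', l')) := by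
      have h4 : ν (b, l) = (v (b.1 : F) * v (b'.1 : F))⁻¹ * (v (b'.1 : F) * N l) := by
        simp only [ν]; field_simp
      have h5 : ν (b', l') = (v (b.1 : F) * v (b'.1 : F))⁻¹ * (v (b.1 : F) * N l') := by
        simp only [ν]; field_simp
      rw [h4, h5, ← mul_max_of_nonneg _ _ (by positivity), ← hNs, ← hNs]
      simp only [ν, m]
      push_cast
      rw [map_mul]
      exact mul_le_mul_of_nonneg_left (hNu _ _) (by positivity)
    refine absurd (hupper (w + w') m) (not_le.mpr (max_lt (hνm.trans_lt (max_lt hlt hlt')) ?_))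
    rw [hum, add_sub_add_comm]
    exact (hTu _ _).trans_lt (max_lt hi hi')
  have hhom_le : ∀ (x : E) w, x ≠ 0 → Ninf (x • w) ≤ e x * Ninf w := by
    intro x w hx
    by_contra! h
    have hex := e.pos hx
    have hpos := (mul_nonneg hex.le (hNinf w).1).trans_lt h
    obtain ⟨i, hi⟩ := hdenseT w (Ninf (x • w) / e x) (div_pos hpos hex)
    rw [lt_div_iff₀' hex] at hi
    obtain ⟨y, hy⟩ := hdense x (min (e x) (Ninf (x • w) / (T w + 1)))
      (lt_min hex (div_pos hpos (by linarith [hT0 w])))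
    rw [lt_min_iff, lt_div_iff₀ (by linarith [hT0 w])] at hy
    have hey : e (algebraMap F E y) = e x := by
      have h1 := he.add_eq_max_of_ne' e (fun a => (e.map_neg a).symm)
        (a := x) (b := -(x - algebraMap F E y)) (by rw [e.map_neg]; exact hy.1.ne')
      rwa [e.map_neg, max_eq_left hy.1.le, neg_sub, add_sub_cancel] at h1
    obtain ⟨d, hdA, hd0, hdy⟩ := hfrac y
    obtain ⟨b, l⟩ := i
    have hdE : algebraMap F E d ≠ 0 := by simpa using hd0
    have hb := hbE b
    let m : I := (⟨⟨d, hdA⟩ * b.1, by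
      intro h0
      have := congrArg (fun a : A => algebraMap F E a) h0
      simp [hdE, hb] at this⟩, (⟨d * y, hdy⟩ : A) • l)
    have hum : u m = algebraMap F E y • u (b, l) := by
      simp only [u, m]
      rw [hj, smul_smul, smul_smul]
      congr 1
      push_cast
      field_simp
    have hνm : ν m = e x * ν (b, l) := by
      simp only [ν, m]
      rw [hNs, ← hey, hext]
      push_cast
      simp only [map_mul]
      have := v.pos hd0
      have := hb0 b
      field_simp
    have h1 : x • w - u m = (x - algebraMap F E y) • w + algebraMap F E y • (w - u (b, l)) := by
      rw [hum, sub_smul, smul_sub, sub_add_sub_cancel]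
    have h2 : T (x • w - u m) < Ninf (x • w) := by
      rw [h1]
      refine (hTu _ _).trans_lt (max_lt ?_ ?_)
      · rw [hTs]
        nlinarith [e.nonneg (x - algebraMap F E y), hT0 w]
      · rw [hTs, hey]
        exact hi
    have h3 : ν m < Ninf (x • w) := by
      rw [hνm]
      refine (mul_le_mul_of_nonneg_left (hlower w (b, l)) hex.le).trans_lt ?_
      rw [mul_max_of_nonneg _ _ hex.le]
      exact max_lt h hi
    exact absurd (hupper (x • w) m) (not_le.mpr (max_lt h3 h2))
  have hN0' : N 0 = 0 := (hNz 0).mpr rfl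
  have hle : ∀ w, Ninf w ≤ T w := by
    intro w
    have := hupper w (one, 0)
    rwa [hu1, hν1, map_zero, sub_zero, hN0', max_eq_right (hT0 w)] at this
  have hNinf0 : Ninf 0 = 0 := by rw [← map_zero j, hrestr, hN0']
  have hhom : ∀ (x : E) w, Ninf (x • w) = e x * Ninf w := by
    intro x w
    rcases eq_or_ne x 0 with rfl | hx
    · simp [hNinf0]
    refine le_antisymm (hhom_le x w hx) ?_
    have := hhom_le x⁻¹ (x • w) (inv_ne_zero hx)
    rwa [inv_smul_smul₀ hx, map_inv₀, le_inv_mul_iff₀ (e.pos hx)] at this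
  refine ⟨Ninf, ⟨fun w => (hNinf w).1, fun w => ⟨fun hw => ?_, ?_⟩, hultra, hhom, hrestr⟩, ?_⟩
  · have hfin := hdiscrete (max R 1) (lt_max_of_lt_right one_pos)
    obtain ⟨B, hB⟩ := (hfin.image fun l => T (j l)).bddAbove
    have hbound : ∀ x : E, e x * T w ≤ max R B := by
      intro x
      obtain ⟨l, hl⟩ := hR (x • w)
      have h1 : N l ≤ max R 1 := by
        rw [← hrestr]
        have h2 := hultra (x • w) ((-1 : E) • (x • w - j l))
        rw [neg_one_smul, neg_sub, add_sub_cancel, hhom, hw, mul_zero] at h2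
        refine h2.trans (max_le (le_max_of_le_right zero_le_one) ?_)
        exact (hle _).trans (by rw [← hTn, neg_sub]; exact hl.trans (le_max_left _ _))
      rw [← hTs]
      have h3 := hTu (x • w - j l) (j l)
      rw [sub_add_cancel] at h3
      exact h3.trans (max_le_max hl (hB ⟨l, h1, rfl⟩))
    refine hTz w ?_
    by_contra hne
    have hpos : 0 < T w := lt_of_le_of_ne (hT0 w) (Ne.symm hne)
    obtain ⟨b, -, hb⟩ := hunb (max R B / T w)
    have := hbound (algebraMap F E b)
    rw [hext] at this
    rw [div_lt_iff₀ hpos] at hb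
    linarith
  · rintro rfl
    exact hNinf0
  · rintro G ⟨hG0, -, hGu, hGs, hGr⟩
    have hGT := hdom G hGu hGs hGr
    have hGn : ∀ w, G (-w) = G w := fun w => by
      rw [← neg_one_smul E w, hGs, e.map_neg, map_one, one_mul]
    have hGi : ∀ i, G (u i) = ν i := fun i => by
      simp only [u, ν]
      rw [hGs, hGr, map_inv₀, hext]
    funext w
    refine huniq w _ ⟨hG0 w, fun i => ⟨?_, ?_⟩⟩
    · rw [← hGi]
      have h1 := hGu w (-(w - u i))
      rw [neg_sub, add_sub_cancel, ← neg_sub, hGn] at h1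
      exact h1.trans (max_le_max le_rfl (hGT _))
    · rw [← hGi]
      have h1 := hGu (u i) (w - u i)
      rw [add_sub_cancel] at h1
      exact h1.trans (max_le_max le_rfl (hGT _))
end Extension

section TensorProduct

lemma IsNonarchimedean.of_dense {F E : Type*} [Field F] [Field E] [Algebra F E]
    {v : AbsoluteValue F ℝ} {e : AbsoluteValue E ℝ}
    (hext : ∀ x : F, e (algebraMap F E x) = v x)
    (hdense : ∀ (y : E) (δ : ℝ), 0 < δ → ∃ x : F, e (y - algebraMap F E x) < δ)
    (hv : IsNonarchimedean v) : IsNonarchimedean e := by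
  have approx : ∀ (y : E) (δ : ℝ), 0 < δ → ∃ x : F, e (y - algebraMap F E x) < δ ∧
      v x ≤ e y + δ := fun y δ hδ => by
    obtain ⟨x, hx⟩ := hdense y δ hδ
    refine ⟨x, hx, ?_⟩
    have h1 := e.sub_le (algebraMap F E x) y 0
    rw [sub_zero, sub_zero, hext, e.map_sub] at h1
    linarith
  intro x y
  refine le_of_forall_pos_le_add fun δ hδ => ?_
  obtain ⟨x', hx, hx'⟩ := approx x (δ / 3) (by positivity)
  obtain ⟨y', hy, hy'⟩ := approx y (δ / 3) (by positivity)
  have h1 : x + y = (x - algebraMap F E x') + (y - algebraMap F E y') + algebraMap F E (x' + y') := by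
    rw [map_add]; ring
  have h2 := e.add_le (x - algebraMap F E x' + (y - algebraMap F E y')) (algebraMap F E (x' + y'))
  have h3 := e.add_le (x - algebraMap F E x') (y - algebraMap F E y')
  rw [hext] at h2
  have h4 : v (x' + y') ≤ max (e x) (e y) + δ / 3 := by
    rw [← max_add_add_right]
    exact (hv x' y').trans (max_le_max hx' hy')
  rw [← h1] at h2
  linarith

lemma apply_sum_le_of_ultrametric {V ι : Type*} [AddCommMonoid V] {G : V → ℝ}
    (hG : ∀ w w', G (w + w') ≤ max (G w) (G w')) {s : Finset ι} {f : ι → V} {t : ℝ}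
    (h0 : G 0 ≤ t) (h : ∀ i ∈ s, G (f i) ≤ t) : G (∑ i ∈ s, f i) ≤ t :=
  Finset.sum_induction f (fun x => G x ≤ t) (fun a b ha hb => (hG a b).trans (max_le ha hb)) h0 h

/-- Coordinates on `E ⊗ Λ` for a finitely generated projective module `Λ`. -/
lemma exists_coordinates {R E Λ : Type*} [CommRing R] [CommRing E] [Algebra R E]
    [AddCommGroup Λ] [Module R Λ] [Module.Finite R Λ] [Module.Projective R Λ] :
    ∃ (n : ℕ) (l : Fin n → Λ) (φ : Fin n → Λ →ₗ[R] R) (ξ : Fin n → (E ⊗[R] Λ) →ₗ[E] E),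
      (∀ m, ∑ i, φ i m • l i = m) ∧ (∀ w, ∑ i, ξ i w • ((1 : E) ⊗ₜ[R] l i) = w) ∧
      ∀ i m, ξ i (1 ⊗ₜ m) = algebraMap R E (φ i m) := by
  obtain ⟨n, f, g, -, -, hfg⟩ := Module.Finite.exists_comp_eq_id_of_projective R Λ
  let φ : Fin n → Λ →ₗ[R] R := fun i => LinearMap.proj i ∘ₗ g
  have hφ : ∀ m, ∑ i, φ i m • f (Pi.single i 1) = m := fun m => by
    have h1 := LinearMap.congr_fun hfg m
    rw [LinearMap.comp_apply, LinearMap.id_apply, pi_eq_sum_univ' (g m), map_sum] at h1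
    conv_rhs => rw [← h1]
    refine Finset.sum_congr rfl fun i _ => ?_
    rw [map_smul]
    congr 2
  let ξ : Fin n → (E ⊗[R] Λ) →ₗ[E] E := fun i =>
    (TensorProduct.AlgebraTensorModule.rid R E E).toLinearMap ∘ₗ (φ i).baseChange E
  have hξ : ∀ i x m, ξ i (x ⊗ₜ m) = φ i m • x := fun i x m => by simp [ξ]
  refine ⟨n, fun i => f (Pi.single i 1), φ, ξ, hφ, fun w => ?_, fun i m => by
    rw [hξ, Algebra.smul_def, mul_one]⟩
  induction w with
  | zero => simp
  | add x y hx hy =>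
    conv_rhs => rw [← hx, ← hy]
    simp only [map_add, add_smul, Finset.sum_add_distrib]
  | tmul x m =>
    conv_rhs => rw [← hφ m, TensorProduct.tmul_sum]
    refine Finset.sum_congr rfl fun i _ => ?_
    rw [hξ, TensorProduct.smul_tmul', smul_eq_mul, mul_one, TensorProduct.smul_tmul]

/-- A discrete norm on a finitely generated projective `A`-module extends uniquely to the
completion, when `A` is cobounded in its unbounded fraction field. -/
theorem existsUnique_norm_extension_tensorProduct {F E Λ : Type*} [Field F] [Field E] [Algebra F E]
    {v : AbsoluteValue F ℝ} {e : AbsoluteValue E ℝ}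
    (hext : ∀ x : F, e (algebraMap F E x) = v x)
    (hdense : ∀ (y : E) (δ : ℝ), 0 < δ → ∃ x : F, e (y - algebraMap F E x) < δ)
    (hv : IsNonarchimedean v) {A : Subring F}
    (hfrac : ∀ f : F, ∃ b ∈ A, b ≠ 0 ∧ b * f ∈ A) (hunb : ∀ C : ℝ, ∃ b ∈ A, C < v b)
    {R : ℝ} (hR : ∀ f : F, ∃ a ∈ A, v (f - a) ≤ R)
    [AddCommGroup Λ] [Module A Λ] [Module.Finite A Λ] [Module.Projective A Λ] {N : Λ → ℝ}
    (hN0 : ∀ l, 0 ≤ N l) (hNz : ∀ l, N l = 0 ↔ l = 0)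
    (hNu : ∀ l l', N (l + l') ≤ max (N l) (N l'))
    (hNs : ∀ (a : A) l, N (a • l) = v (a : F) * N l)
    (hdiscrete : ∀ r : ℝ, 0 < r → {l | N l ≤ r}.Finite) :
    ∃! Ninf : E ⊗[A] Λ → ℝ, (∀ w, 0 ≤ Ninf w) ∧ (∀ w, Ninf w = 0 ↔ w = 0) ∧
      (∀ w w', Ninf (w + w') ≤ max (Ninf w) (Ninf w')) ∧
      (∀ (x : E) (w : E ⊗[A] Λ), Ninf (x • w) = e x * Ninf w) ∧
      ∀ l : Λ, Ninf ((1 : E) ⊗ₜ l) = N l := by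
  have he := IsNonarchimedean.of_dense hext hdense hv
  have hext' : ∀ a : A, e (algebraMap A E a) = v (a : F) := fun a => hext a
  obtain ⟨n, b, φ, ξ, hφ, hξ, hξφ⟩ := exists_coordinates (R := A) (E := E) (Λ := Λ)
  obtain ⟨M, hM0, hM⟩ : ∃ M : ℝ, 0 < M ∧ ∀ i, N (b i) ≤ M :=
    ⟨1 + ∑ i, N (b i), add_pos_of_pos_of_nonneg one_pos (Finset.sum_nonneg fun i _ => hN0 _),
      fun i => (Finset.single_le_sum (fun i _ => hN0 (b i)) (Finset.mem_univ i)).trans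
        (le_add_of_nonneg_left zero_le_one)⟩
  let T : E ⊗[A] Λ → ℝ := fun w => M * ⨆ i, e (ξ i w)
  have hle : ∀ w i, e (ξ i w) ≤ ⨆ i, e (ξ i w) := fun w i =>
    le_ciSup (f := fun i => e (ξ i w)) (Set.finite_range _).bddAbove i
  have hT0 : ∀ w, 0 ≤ T w := fun w =>
    mul_nonneg hM0.le (Real.iSup_nonneg fun i => e.nonneg _)
  have hTs : ∀ (x : E) w, T (x • w) = e x * T w := fun x w => by
    simp only [T, map_smul, smul_eq_mul, map_mul]
    rw [← Real.mul_iSup_of_nonneg (e.nonneg x), mul_left_comm]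
  have hTu : ∀ w w', T (w + w') ≤ max (T w) (T w') := fun w w' => by
    rw [← mul_max_of_nonneg _ _ hM0.le]
    refine mul_le_mul_of_nonneg_left (Real.iSup_le (fun i => ?_)
      (le_max_of_le_left (Real.iSup_nonneg fun i => e.nonneg _))) hM0.le
    rw [map_add]
    exact (he _ _).trans (max_le_max (hle w i) (hle w' i))
  have hTz : ∀ w, T w = 0 → w = 0 := fun w hw => by
    rw [← hξ w]
    refine Finset.sum_eq_zero fun i _ => ?_
    have h0 := (mul_eq_zero.mp hw).resolve_left hM0.ne'
    rw [e.eq_zero.mp (le_antisymm ((hle w i).trans h0.le) (e.nonneg _)), zero_smul]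
  have hmul : ∀ w i, e (ξ i w) * N (b i) ≤ T w := fun w i => by
    rw [mul_comm]
    exact mul_le_mul (hM i) (hle w i) (e.nonneg _) hM0.le
  refine existsUnique_norm_extension (A := A) (T := T)
    (j := (TensorProduct.mk A E Λ 1).toAddMonoidHom)
    hext hdense he hfrac hunb hN0 hNz hNu hNs hdiscrete (fun a l => ?_) hT0 hTz hTu hTs
    (fun l => ?_) ?_ (fun G hGu hGs hGN w => ?_)
  · change (1 : E) ⊗ₜ[A] (a • l) = algebraMap A E a • (1 : E) ⊗ₜ[A] l
    rw [algebraMap_smul, TensorProduct.tmul_smul]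
  · change N l ≤ T ((1 : E) ⊗ₜ[A] l)
    conv_lhs => rw [← hφ l]
    refine apply_sum_le_of_ultrametric hNu (((hNz 0).mpr rfl).trans_le (hT0 _)) fun i _ => ?_
    rw [hNs, ← hext', ← hξφ]
    exact hmul _ i
  · have hpos : 0 < max R 1 := zero_lt_one.trans_le (le_max_right _ _)
    have happrox : ∀ x : E, ∃ a : A, e (x - algebraMap A E a) ≤ max R 1 := fun x => by
      obtain ⟨f, hf⟩ := hdense x _ hpos
      obtain ⟨a, ha, h⟩ := hR f
      refine ⟨⟨a, ha⟩, ?_⟩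
      have h1 : x - algebraMap A E ⟨a, ha⟩ =
          (x - algebraMap F E f) + algebraMap F E (f - a) := by
        rw [map_sub, sub_add_sub_cancel]
        rfl
      rw [h1]
      refine (he _ _).trans (max_le hf.le ?_)
      rw [hext]
      exact h.trans (le_max_left _ _)
    choose α hα using happrox
    refine ⟨max R 1 * ∑ i, T ((1 : E) ⊗ₜ[A] b i), fun w => ⟨∑ i, α (ξ i w) • b i, ?_⟩⟩
    have h1 : w - (TensorProduct.mk A E Λ 1).toAddMonoidHom (∑ i, α (ξ i w) • b i) =
        ∑ i, (ξ i w - algebraMap A E (α (ξ i w))) • ((1 : E) ⊗ₜ[A] b i) := by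
      change w - (1 : E) ⊗ₜ[A] (∑ i, α (ξ i w) • b i) = _
      have h2 : ∀ i, (ξ i w - algebraMap A E (α (ξ i w))) • ((1 : E) ⊗ₜ[A] b i) =
          ξ i w • ((1 : E) ⊗ₜ[A] b i) - (1 : E) ⊗ₜ[A] (α (ξ i w) • b i) := fun i => by
        refine (sub_smul (ξ i w) (algebraMap A E (α (ξ i w))) ((1 : E) ⊗ₜ[A] b i)).trans
          (congrArg _ ?_)
        rw [algebraMap_smul, TensorProduct.tmul_smul]
      rw [Finset.sum_congr rfl fun i _ => h2 i, Finset.sum_sub_distrib, hξ,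
        TensorProduct.tmul_sum]
    rw [h1]
    have hsum : ∀ i, T ((1 : E) ⊗ₜ[A] b i) ≤ ∑ i, T ((1 : E) ⊗ₜ[A] b i) := fun i =>
      Finset.single_le_sum (f := fun i => T ((1 : E) ⊗ₜ[A] b i)) (fun i _ => hT0 _)
        (Finset.mem_univ i)
    refine apply_sum_le_of_ultrametric hTu ?_ fun i _ => ?_
    · rw [← zero_smul E (0 : E ⊗[A] Λ), hTs, map_zero, zero_mul]
      exact mul_nonneg hpos.le (Finset.sum_nonneg fun i _ => hT0 _)
    · rw [hTs]
      exact mul_le_mul (hα _) (hsum i) (hT0 _) hpos.le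
  · rw [← hξ w]
    refine apply_sum_le_of_ultrametric hGu ?_ fun i _ => ?_
    · rw [← zero_smul E (0 : E ⊗[A] Λ), hGs, map_zero, zero_mul]
      exact hT0 _
    · rw [hGs, hξ]
      exact (congrArg (e (ξ i w) * ·) (hGN (b i))).trans_le (hmul w i)

end TensorProduct

/-- Let `F` be a global function field with a place `∞` (an absolute value `|·|_∞` with value
group `c^ℤ`, `c` the residue cardinality at `∞`), `A ⊆ F` the ring of elements regular
outside `∞`, and `F_∞` the completion of `F` at `∞`.  Let `Λ` be an `A`-lattice: a finitely
generated projective `A`-module with an `∞`-adic norm `‖·‖` inducing the discrete topology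
(all balls `Λ_{≤r}` are finite).  Then the norm on `Λ` extends to a unique `∞`-adic norm on
the `F_∞`-vector space `V_∞ = F_∞ ⊗_A Λ`. -/
theorem lattice_norm_extends_to_completion
    (Fq F : Type*) [Field Fq] [Fintype Fq] [Field F]
    [Algebra (RatFunc Fq) F] [FiniteDimensional (RatFunc Fq) F]
    (absF : AbsoluteValue F ℝ)
    (hna : ∀ x y : F, absF (x + y) ≤ max (absF x) (absF y))
    (c : ℕ) (hc : 1 < c)
    (hdisc : ∀ x : F, x ≠ 0 → ∃ k : ℤ, absF x = (c : ℝ) ^ k)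
    (hπ : ∃ π : F, absF π = (c : ℝ)⁻¹)
    (hres : ∃ S : Finset F, S.card = c ∧ ∀ x : F, absF x ≤ 1 →
      ∃! y, y ∈ S ∧ absF (x - y) < 1)
    (A : Subring F)
    (hA : ∀ x : F, x ∈ A ↔ ∀ O : ValuationSubring F,
      (O : Set F) ≠ Set.univ → (O : Set F) ≠ {y : F | absF y ≤ 1} → x ∈ O)
    -- the completion `F_∞` of `F` at `∞`
    (Finf : Type*) [Field Finf] [Algebra F Finf]
    (absinf : AbsoluteValue Finf ℝ)
    (hext : ∀ x : F, absinf (algebraMap F Finf x) = absF x)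
    (hdense : ∀ (y : Finf) (δ : ℝ), 0 < δ → ∃ x : F, absinf (y - algebraMap F Finf x) < δ)
    (hcomplete : ∀ s : ℕ → Finf,
      (∀ δ : ℝ, 0 < δ → ∃ n₀ : ℕ, ∀ m n : ℕ, n₀ ≤ m → n₀ ≤ n → absinf (s m - s n) < δ) →
      ∃ L : Finf, ∀ δ : ℝ, 0 < δ → ∃ n₀ : ℕ, ∀ n : ℕ, n₀ ≤ n → absinf (s n - L) < δ)
    -- the `A`-lattice `Λ`
    (Λ : Type*) [AddCommGroup Λ] [Module ↥A Λ]
    [Module.Finite ↥A Λ] [Module.Projective ↥A Λ]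
    (N : Λ → ℝ)
    (hN0 : ∀ l : Λ, 0 ≤ N l)
    (hNz : ∀ l : Λ, N l = 0 ↔ l = 0)
    (hNu : ∀ l l' : Λ, N (l + l') ≤ max (N l) (N l'))
    (hNs : ∀ (a : ↥A) (l : Λ), N (a • l) = absF (a : F) * N l)
    (hdiscrete : ∀ r : ℝ, 0 < r → {l : Λ | N l ≤ r}.Finite) :
    ∃! Ninf : Finf ⊗[↥A] Λ → ℝ,
      (∀ w, 0 ≤ Ninf w) ∧
      (∀ w, Ninf w = 0 ↔ w = 0) ∧
      (∀ w w', Ninf (w + w') ≤ max (Ninf w) (Ninf w')) ∧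
      (∀ (x : Finf) (w : Finf ⊗[↥A] Λ), Ninf (x • w) = absinf x * Ninf w) ∧
      (∀ l : Λ, Ninf ((1 : Finf) ⊗ₜ l) = N l) := by
  have hv : IsNonarchimedean absF := hna
  have hc' : (1 : ℝ) < c := by exact_mod_cast hc
  obtain ⟨π, hπ⟩ := hπ
  have hπ1 : absF π < 1 := by
    rw [hπ]
    exact inv_lt_one_of_one_lt₀ hc'
  have hπ0 : π ≠ 0 := by
    rintro rfl
    rw [map_zero] at hπ
    exact (inv_pos.mpr (zero_lt_one.trans hc')).ne hπ
  obtain ⟨hfrac, R, hR⟩ := regular_outside_place (k := Fq) hv hπ0 hπ1 (fun x => (hA x).mpr)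
  have hunb : ∀ C : ℝ, ∃ b ∈ A, C < absF b := fun C => by
    obtain ⟨m, hm⟩ := pow_unbounded_of_one_lt (C + R) hc'
    obtain ⟨a, ha, h⟩ := hR (π⁻¹ ^ m)
    refine ⟨a, ha, ?_⟩
    have h1 := absF.add_le (π⁻¹ ^ m - a) a
    rw [sub_add_cancel, map_pow, map_inv₀, hπ, inv_inv] at h1
    linarith
  exact existsUnique_norm_extension_tensorProduct hext hdense hv hfrac hunb hR hN0 hNz hNu hNs
    hdiscrete
end

section
/- Let Λ be an A-lattice and let V = F ⊗_A Λ carry the unique ∞-adic norm extending the norm of Λ. Then for each real number r > 0 the ball V_{≤r} = {v ∈ V : ‖v‖ ≤ r} is finitely generated as a module over the valuation ring O_{F,∞} of the place ∞ in F. -/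
open scoped TensorProduct

/-- The ideal of elements of `R` that are not units of the valuation ring `O`. -/
def ValuationSubring.center {R F : Type*} [CommRing R] [Field F] (φ : R →+* F)
    (O : ValuationSubring F) (hO : ∀ r, φ r ∈ O) : Ideal R :=
  (IsLocalRing.maximalIdeal O).comap (φ.codRestrict O.toSubring hO)

namespace ValuationSubring

variable {R F : Type*} [CommRing R] [Field F] (φ : R →+* F)

instance center_isPrime (O : ValuationSubring F) (hO : ∀ r, φ r ∈ O) :
    (O.center φ hO).IsPrime :=
  Ideal.comap_isPrime _ _

lemma mem_center_iff {O : ValuationSubring F} {hO : ∀ r, φ r ∈ O} {r : R} :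
    r ∈ O.center φ hO ↔ O.valuation (φ r) < 1 :=
  O.valuation_lt_one_iff ⟨φ r, hO r⟩

lemma valuation_eq_one_of_notMem_center {O : ValuationSubring F} {hO : ∀ r, φ r ∈ O} {r : R}
    (hr : r ∉ O.center φ hO) : O.valuation (φ r) = 1 :=
  le_antisymm ((O.valuation_le_one_iff _).2 (hO r)) (not_lt.1 fun h ↦ hr ((mem_center_iff φ).2 h))

lemma div_mem_of_mul_eq {O : ValuationSubring F} {hO : ∀ r, φ r ∈ O} {a b c s : R}
    (hb : φ b ≠ 0) (hc : c ∉ O.center φ hO) (h : a * c = b * s) : φ a / φ b ∈ O := by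
  have h1 := valuation_eq_one_of_notMem_center φ hc
  have hc0 : φ c ≠ 0 := fun h0 ↦ by simp [h0] at h1
  have h2 : φ a / φ b = φ s / φ c := by
    rw [div_eq_div_iff hb hc0, ← map_mul, h, map_mul, mul_comm]
  rw [h2, ← O.valuation_le_one_iff, map_div₀, h1, div_one, O.valuation_le_one_iff]
  exact hO s

variable [IsDedekindDomain R]

lemma _root_.Ideal.exists_span_singleton_eq_pow_mul {P : Ideal R} [hP : P.IsPrime] (hP0 : P ≠ ⊥)
    {q : R} (hq : q ≠ 0) :
    ∃ (k : ℕ) (J : Ideal R), Ideal.span {q} = P ^ k * J ∧ ¬ J ≤ P := by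
  have hfin : FiniteMultiplicity P (Ideal.span {q}) :=
    FiniteMultiplicity.of_prime_left (Ideal.prime_of_isPrime hP0 hP) (by simpa using hq)
  obtain ⟨J, h, hJ⟩ := hfin.exists_eq_pow_mul_and_not_dvd
  exact ⟨_, J, h, fun hle ↦ hJ (Ideal.dvd_iff_le.2 hle)⟩

/-- The localization of a Dedekind domain at a nonzero prime is a valuation ring. -/
lemma _root_.Ideal.exists_mul_eq_mul_notMem {P : Ideal R} [hP : P.IsPrime] (hP0 : P ≠ ⊥)
    {a b : R} (ha : a ≠ 0) (hb : b ≠ 0) :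
    ∃ s t : R, a * t = b * s ∧ (s ∉ P ∨ t ∉ P) := by
  obtain ⟨k, I, hI, hIP⟩ := Ideal.exists_span_singleton_eq_pow_mul hP0 ha
  obtain ⟨l, J, hJ, hJP⟩ := Ideal.exists_span_singleton_eq_pow_mul hP0 hb
  obtain ⟨i, hi, hiP⟩ := SetLike.not_le_iff_exists.1 hIP
  obtain ⟨j, hj, hjP⟩ := SetLike.not_le_iff_exists.1 hJP
  have ha' : a ∈ P ^ k := Ideal.mul_le_left (J := I) (by
    rw [← hI]; exact Ideal.mem_span_singleton_self a)
  have hb' : b ∈ P ^ l := Ideal.mul_le_left (J := J) (by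
    rw [← hJ]; exact Ideal.mem_span_singleton_self b)
  rcases le_total k l with hkl | hkl
  · have : b * i ∈ Ideal.span {a} := by
      rw [hI]; exact Ideal.mul_mem_mul (Ideal.pow_le_pow_right hkl hb') hi
    obtain ⟨t, ht⟩ := Ideal.mem_span_singleton'.1 this
    exact ⟨i, t, by rw [← ht, mul_comm], Or.inl hiP⟩
  · have : a * j ∈ Ideal.span {b} := by
      rw [hJ]; exact Ideal.mul_mem_mul (Ideal.pow_le_pow_right hkl ha') hj
    obtain ⟨s, hs⟩ := Ideal.mem_span_singleton'.1 this
    exact ⟨s, j, by rw [← hs, mul_comm], Or.inr hjP⟩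

variable (hφ : Function.Injective φ)
  (hpow : ∀ f : F, ∃ n : ℕ, n ≠ 0 ∧ ∃ a b : R, b ≠ 0 ∧ f ^ n * φ b = φ a)

lemma mem_of_pow_mem {O : ValuationSubring F} {f : F} {n : ℕ} (hn : n ≠ 0) (h : f ^ n ∈ O) :
    f ∈ O := by
  rw [← O.valuation_le_one_iff] at h ⊢
  rw [map_pow] at h
  exact (pow_le_one_iff hn).1 h

include hφ hpow

omit [IsDedekindDomain R] in
lemma center_ne_bot {O : ValuationSubring F} (hO : ∀ r, φ r ∈ O) (hne : O ≠ ⊤) :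
    O.center φ hO ≠ ⊥ := by
  intro hbot
  refine hne (top_unique fun f _ ↦ ?_)
  obtain ⟨n, hn, a, b, hb, h⟩ := hpow f
  refine mem_of_pow_mem hn ?_
  have hb' : φ b ≠ 0 := (map_ne_zero_iff φ hφ).2 hb
  rw [eq_div_of_mul_eq hb' h]
  exact div_mem_of_mul_eq φ hb' (hbot ▸ hb : b ∉ O.center φ hO) (mul_comm a b)

lemma le_of_center_eq {O O' : ValuationSubring F} (hO : ∀ r, φ r ∈ O) (hO' : ∀ r, φ r ∈ O')
    (hne : O ≠ ⊤) (h : O.center φ hO = O'.center φ hO') : O ≤ O' := by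
  intro f hf
  obtain ⟨n, hn, a, b, hb, hab⟩ := hpow f
  rcases eq_or_ne a 0 with rfl | ha
  · have hb' : φ b ≠ 0 := (map_ne_zero_iff φ hφ).2 hb
    have : f = 0 := by simpa [hb', hn] using hab
    exact this ▸ O'.zero_mem
  have hb' : φ b ≠ 0 := (map_ne_zero_iff φ hφ).2 hb
  have hfn := eq_div_of_mul_eq hb' hab
  obtain ⟨s, t, hst, hP⟩ := Ideal.exists_mul_eq_mul_notMem
    (center_ne_bot φ hφ hpow hO hne) ha hb
  refine mem_of_pow_mem hn (hfn ▸ div_mem_of_mul_eq (hO := hO') (c := t) φ hb' (fun ht ↦ ?_) hst)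
  rw [← h] at ht
  have hs := hP.resolve_right (not_not.2 ht)
  have h1 := valuation_eq_one_of_notMem_center φ hs
  have h2 := (mem_center_iff φ).1 ht
  have h3 : O.valuation (f ^ n) ≤ 1 := (O.valuation_le_one_iff _).2 (pow_mem hf n)
  have h4 : f ^ n * φ t = φ s := by
    rw [hfn, div_mul_eq_mul_div, ← map_mul, hst, map_mul, mul_div_cancel_left₀ _ hb']
  have h5 := congrArg O.valuation h4
  rw [map_mul, h1] at h5
  exact ((mul_le_of_le_one_left' h3).trans_lt h2).ne h5

/-- Simultaneous approximation: there is an element of a Dedekind domain `R` that is divisible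
by `q` in all nontrivial valuation rings over `R` other than `O`, while it is congruent
to `1` modulo `q` in `O`. -/
lemma exists_approx {O : ValuationSubring F} (hO : ∀ r, φ r ∈ O) (hne : O ≠ ⊤)
    {q : R} (hq : q ≠ 0) :
    ∃ e : R, φ (1 - e) / φ q ∈ O ∧
      ∀ O' : ValuationSubring F, (∀ r, φ r ∈ O') → O' ≠ ⊤ → O' ≠ O → φ e / φ q ∈ O' := by
  have hP0 := center_ne_bot φ hφ hpow hO hne
  have hq' : φ q ≠ 0 := (map_ne_zero_iff φ hφ).2 hq
  have hmax : (O.center φ hO).IsMaximal := (center_isPrime φ O hO).isMaximal hP0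
  obtain ⟨k, J, hJ, hJP⟩ := Ideal.exists_span_singleton_eq_pow_mul hP0 hq
  have hcop : IsCoprime (O.center φ hO ^ k) J := by
    refine IsCoprime.pow_left (Ideal.isCoprime_iff_sup_eq.2 ?_)
    exact hmax.1.2 _ (lt_of_le_of_ne le_sup_left fun h ↦ hJP (h ▸ le_sup_right))
  obtain ⟨i, hi, j, hj, hij⟩ := Ideal.isCoprime_iff_exists.1 hcop
  refine ⟨j, ?_, fun O' hO' hne' hOO' ↦ ?_⟩
  · obtain ⟨j', hj', hjP⟩ := SetLike.not_le_iff_exists.1 hJP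
    have : i * j' ∈ Ideal.span {q} := by
      rw [hJ]; exact Ideal.mul_mem_mul hi hj'
    obtain ⟨s, hs⟩ := Ideal.mem_span_singleton'.1 this
    rw [← hij, add_sub_cancel_right]
    exact div_mem_of_mul_eq φ hq' hjP (by rw [← hs, mul_comm])
  · have hnle : ¬ O.center φ hO ≤ O'.center φ hO' := fun hle ↦ by
      have heq := hmax.eq_of_le (center_isPrime φ O' hO').ne_top hle
      exact hOO' (le_antisymm (le_of_center_eq φ hφ hpow hO' hO hne' heq.symm)
        (le_of_center_eq φ hφ hpow hO hO' hne heq))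
    obtain ⟨i', hi', hiP⟩ := SetLike.not_le_iff_exists.1 hnle
    have : j * i' ^ k ∈ Ideal.span {q} := by
      rw [hJ, mul_comm j]; exact Ideal.mul_mem_mul (Ideal.pow_mem_pow hi' k) hj
    obtain ⟨s, hs⟩ := Ideal.mem_span_singleton'.1 this
    exact div_mem_of_mul_eq φ hq' (fun h ↦ hiP ((center_isPrime φ O' hO').mem_of_pow_mem k h))
      (by rw [← hs, mul_comm])

end ValuationSubring

open scoped Polynomial

lemma Valuation.le_of_monic_aeval_eq_zero {S F Γ : Type*} [CommRing S] [Field F] [Algebra S F]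
    [LinearOrderedCommGroupWithZero Γ] (v : Valuation F Γ) {p : S[X]} (hp : p.Monic) {ω : F}
    (h0 : Polynomial.aeval ω p = 0) {γ : Γ} (hγ : 1 ≤ γ)
    (hcoeff : ∀ i, v (algebraMap S F (p.coeff i)) ≤ γ) : v ω ≤ γ := by
  by_contra! hlt
  have h1 : 1 < v ω := hγ.trans_lt hlt
  rw [Polynomial.aeval_eq_sum_range, Finset.sum_range_succ, hp.coeff_natDegree, one_smul] at h0
  have h2 : v (∑ i ∈ Finset.range p.natDegree, p.coeff i • ω ^ i) < v ω ^ p.natDegree := by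
    refine v.map_sum_lt (pow_ne_zero _ (zero_lt_one.trans h1).ne') fun i hi ↦ ?_
    rw [Algebra.smul_def, map_mul, map_pow]
    calc v (algebraMap S F (p.coeff i)) * v ω ^ i ≤ γ * v ω ^ i := by
          gcongr; exact hcoeff i
      _ < v ω * v ω ^ i := by
          gcongr
          exact pow_pos (zero_lt_one.trans h1) i
      _ = v ω ^ (i + 1) := (pow_succ' _ _).symm
      _ ≤ v ω ^ p.natDegree := pow_le_pow_right₀ h1.le (Finset.mem_range.1 hi)
  rw [eq_neg_of_add_eq_zero_left h0, v.map_neg, map_pow] at h2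
  exact h2.false

namespace FunctionField

variable {Fq F : Type*} [Field Fq] [Finite Fq] [Field F] [Algebra Fq F] [Algebra Fq[X] F]
  [IsScalarTower Fq Fq[X] F]

omit [Finite Fq] in
lemma algebraMap_eq_aeval (p : Fq[X]) :
    algebraMap Fq[X] F p = Polynomial.aeval (algebraMap Fq[X] F Polynomial.X) p := by
  rw [Polynomial.aeval_algebraMap_apply, Polynomial.aeval_X_left_apply]

lemma algebraMap_mem {O : ValuationSubring F} (hX : algebraMap Fq[X] F Polynomial.X ∈ O)
    (p : Fq[X]) : algebraMap Fq[X] F p ∈ O := by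
  rw [algebraMap_eq_aeval, Polynomial.aeval_eq_sum_range]
  refine sum_mem fun i _ ↦ ?_
  rw [Algebra.smul_def]
  exact mul_mem ((O.valuation_le_one_iff _).1 (FiniteField.valuation_algebraMap_le_one O.valuation _))
    (pow_mem hX i)

lemma div_mem {O : ValuationSubring F} (hX : algebraMap Fq[X] F Polynomial.X ∉ O)
    {p q : Fq[X]} (hq : q ≠ 0) (h : p.natDegree ≤ q.natDegree) :
    algebraMap Fq[X] F p / algebraMap Fq[X] F q ∈ O := by
  rcases eq_or_ne p 0 with rfl | hp
  · simp
  have h1 : 1 < O.valuation (algebraMap Fq[X] F Polynomial.X) := by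
    rwa [← not_le, O.valuation_le_one_iff]
  rw [← O.valuation_le_one_iff, map_div₀, algebraMap_eq_aeval, algebraMap_eq_aeval q,
    Polynomial.valuation_aeval_eq_valuation_X_pow_natDegree_of_one_lt_valuation_X _ h1 hp,
    Polynomial.valuation_aeval_eq_valuation_X_pow_natDegree_of_one_lt_valuation_X _ h1 hq]
  exact div_le_one_of_le₀ (pow_le_pow_right₀ h1.le h) zero_le

lemma mem_of_isIntegral {O : ValuationSubring F} (hX : algebraMap Fq[X] F Polynomial.X ∈ O)
    {ω : F} (hω : IsIntegral Fq[X] ω) : ω ∈ O := by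
  obtain ⟨p, hp, h0⟩ := hω
  rw [← O.valuation_le_one_iff]
  exact O.valuation.le_of_monic_aeval_eq_zero hp h0 le_rfl
    fun i ↦ (O.valuation_le_one_iff _).2 (algebraMap_mem hX _)

lemma exists_div_X_pow_mem {ω : F} (hω : IsIntegral Fq[X] ω) :
    ∃ N : ℕ, ∀ O : ValuationSubring F, algebraMap Fq[X] F Polynomial.X ∉ O →
      ω / algebraMap Fq[X] F Polynomial.X ^ N ∈ O := by
  obtain ⟨p, hp, h0⟩ := hω
  refine ⟨p.support.sup fun i ↦ (p.coeff i).natDegree, fun O hX ↦ ?_⟩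
  have h1 : 1 < O.valuation (algebraMap Fq[X] F Polynomial.X) := by
    rwa [← not_le, O.valuation_le_one_iff]
  rw [← O.valuation_le_one_iff, map_div₀, map_pow]
  refine div_le_one_of_le₀ ?_ zero_le
  refine O.valuation.le_of_monic_aeval_eq_zero hp h0 (one_le_pow₀ h1.le) fun i ↦ ?_
  rcases eq_or_ne (p.coeff i) 0 with hi | hi
  · simp [hi]
  rw [algebraMap_eq_aeval,
    Polynomial.valuation_aeval_eq_valuation_X_pow_natDegree_of_one_lt_valuation_X _ h1 hi]
  exact pow_le_pow_right₀ h1.le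
    (Finset.le_sup (f := fun i ↦ (p.coeff i).natDegree) (Polynomial.mem_support_iff.2 hi))

variable [Algebra (RatFunc Fq) F] [IsScalarTower Fq[X] (RatFunc Fq) F]

lemma exists_finite_decomposition_smul {ω : F} (hω : IsIntegral Fq[X] ω) :
    ∃ T : Set F, T.Finite ∧ ∀ f : RatFunc Fq, ∃ b r t : F,
      (∀ O : ValuationSubring F, algebraMap Fq[X] F Polynomial.X ∉ O → b ∈ O) ∧
      (∀ O : ValuationSubring F, algebraMap Fq[X] F Polynomial.X ∈ O → r ∈ O) ∧
      t ∈ T ∧ f • ω = b + r + t := by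
  obtain ⟨N, hN⟩ := exists_div_X_pow_mem hω
  set x := algebraMap Fq[X] F Polynomial.X with hx
  have hinj : Function.Injective (algebraMap Fq[X] F) := algebraMap_injective Fq F
  have hx0 : x ≠ 0 := (map_ne_zero_iff _ hinj).2 Polynomial.X_ne_zero
  have hfin : Finite (Polynomial.degreeLT Fq N) := Module.finite_of_finite Fq
  refine ⟨(fun a ↦ algebraMap Fq[X] F a / x ^ N * ω) '' (Polynomial.degreeLT Fq N),
    (Set.toFinite _).image _, fun f ↦ ?_⟩
  have hq0 : f.denom ≠ 0 := f.denom_ne_zero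
  set a := (Polynomial.X ^ N * f.num) / f.denom with ha
  set s := (Polynomial.X ^ N * f.num) % f.denom with hs
  have h1 : f.denom * a + s = Polynomial.X ^ N * f.num := EuclideanDomain.div_add_mod _ _
  have h2 : Polynomial.X ^ N * (a / Polynomial.X ^ N) + a % Polynomial.X ^ N = a :=
    EuclideanDomain.div_add_mod _ _
  have hXN : (Polynomial.X ^ N : Fq[X]) ≠ 0 := pow_ne_zero _ Polynomial.X_ne_zero
  refine ⟨algebraMap Fq[X] F s / algebraMap Fq[X] F f.denom * (ω / x ^ N),
    algebraMap Fq[X] F (a / Polynomial.X ^ N) * ω,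
    algebraMap Fq[X] F (a % Polynomial.X ^ N) / x ^ N * ω, fun O hO ↦ ?_, fun O hO ↦ ?_,
    ⟨_, ?_, rfl⟩, ?_⟩
  · exact mul_mem (div_mem hO hq0 (Polynomial.natDegree_le_natDegree
      (Polynomial.degree_mod_lt _ hq0).le)) (hN O hO)
  · exact mul_mem (algebraMap_mem hO _) (mem_of_isIntegral hO hω)
  · rw [SetLike.mem_coe, Polynomial.mem_degreeLT]
    simpa using Polynomial.degree_mod_lt a hXN
  · have hq' : algebraMap Fq[X] F f.denom ≠ 0 := (map_ne_zero_iff _ hinj).2 hq0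
    have hf : algebraMap (RatFunc Fq) F f =
        algebraMap Fq[X] F f.num / algebraMap Fq[X] F f.denom := by
      conv_lhs => rw [← f.num_div_denom]
      rw [map_div₀, ← IsScalarTower.algebraMap_apply, ← IsScalarTower.algebraMap_apply]
    have h1' := congrArg (algebraMap Fq[X] F) h1
    have h2' := congrArg (algebraMap Fq[X] F) h2
    simp only [map_add, map_mul, map_pow, ← hx] at h1' h2'
    rw [Algebra.smul_def, hf]
    field_simp
    linear_combination (-ω) * h1' - ω * algebraMap Fq[X] F f.denom * h2'

lemma exists_finite_decomposition [FiniteDimensional (RatFunc Fq) F] :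
    ∃ T : Set F, T.Finite ∧ ∀ f : F, ∃ b r t : F,
      (∀ O : ValuationSubring F, algebraMap Fq[X] F Polynomial.X ∉ O → b ∈ O) ∧
      (∀ O : ValuationSubring F, algebraMap Fq[X] F Polynomial.X ∈ O → r ∈ O) ∧
      t ∈ T ∧ f = b + r + t := by
  obtain ⟨ι, B, hB⟩ := FiniteDimensional.exists_is_basis_integral Fq[X] (RatFunc Fq) F
  choose T hT hdec using fun i ↦ exists_finite_decomposition_smul (hB i)
  refine ⟨(fun t ↦ ∑ i, t i) '' (Set.univ.pi T), (Set.Finite.pi hT).image _, fun f ↦ ?_⟩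
  choose b r t hb hr ht h using hdec
  refine ⟨∑ i, b i (B.repr f i), ∑ i, r i (B.repr f i), ∑ i, t i (B.repr f i),
    fun O hO ↦ sum_mem fun i _ ↦ hb _ _ O hO, fun O hO ↦ sum_mem fun i _ ↦ hr _ _ O hO,
    ⟨_, fun i _ ↦ ht i _, rfl⟩, ?_⟩
  conv_lhs => rw [← B.sum_repr f]
  simp only [h, Finset.sum_add_distrib]

end FunctionField

/-- The valuation ring of a nonarchimedean absolute value, as a valuation subring. -/
def AbsoluteValue.valuationSubring {F : Type*} [Field F] (abv : AbsoluteValue F ℝ)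
    (hna : ∀ x y : F, abv (x + y) ≤ max (abv x) (abv y)) : ValuationSubring F where
  __ := abv.valRing hna
  mem_or_inv_mem' x := by
    change abv x ≤ 1 ∨ abv x⁻¹ ≤ 1
    rw [map_inv₀]
    exact (le_total (abv x) 1).imp id inv_le_one_of_one_le₀

lemma AbsoluteValue.mem_valuationSubring {F : Type*} [Field F] {abv : AbsoluteValue F ℝ}
    {hna : ∀ x y : F, abv (x + y) ≤ max (abv x) (abv y)} {x : F} :
    x ∈ abv.valuationSubring hna ↔ abv x ≤ 1 := Iff.rfl

namespace FunctionField

section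

variable {Fq F : Type*} [Field Fq] [Finite Fq] [Field F] [Algebra Fq F] [Algebra Fq[X] F]
  [IsScalarTower Fq Fq[X] F] [Algebra (RatFunc Fq) F] [IsScalarTower Fq[X] (RatFunc Fq) F]
  [FiniteDimensional (RatFunc Fq) F]

/-- Strong approximation away from one place, for the affine curve with coordinate `X`. -/
lemma exists_sub_mem {O : ValuationSubring F} (hO : algebraMap Fq[X] F Polynomial.X ∈ O)
    (hne : O ≠ ⊤) (f : F) :
    ∃ g : F, f - g ∈ O ∧ ∀ O' : ValuationSubring F,
      algebraMap Fq[X] F Polynomial.X ∈ O' → O' ≠ ⊤ → O' ≠ O → g ∈ O' := by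
  let E := separableClosure (RatFunc Fq) F
  let R := ringOfIntegers Fq E
  have : IsScalarTower Fq[X] E F := .of_algebraMap_eq fun _ ↦ rfl
  let φ : R →+* F := (algebraMap E F).comp (algebraMap R E)
  have hφ : Function.Injective φ :=
    (algebraMap E F).injective.comp (IsFractionRing.injective R E)
  have hφX (p : Fq[X]) : φ (algebraMap Fq[X] R p) = algebraMap Fq[X] F p := rfl
  have hφO {O' : ValuationSubring F} (hO' : algebraMap Fq[X] F Polynomial.X ∈ O') (r : R) :
      φ r ∈ O' := by
    refine mem_of_isIntegral hO' ?_
    have : IsIntegral Fq[X] (r : E) := r.2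
    exact this.map (IsScalarTower.toAlgHom Fq[X] E F)
  have hpow (f : F) : ∃ n : ℕ, n ≠ 0 ∧ ∃ a b : R, b ≠ 0 ∧ f ^ n * φ b = φ a := by
    have : IsPurelyInseparable E F := separableClosure.isPurelyInseparable _ _
    obtain ⟨n, y, hy⟩ := IsPurelyInseparable.pow_mem E (ringExpChar E) f
    obtain ⟨a, b, hb, rfl⟩ := IsFractionRing.div_surjective (A := R) y
    have hb0 := nonZeroDivisors.ne_zero hb
    refine ⟨_, pow_ne_zero n (expChar_ne_zero E (ringExpChar E)), a, b, hb0, ?_⟩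
    have hb' : φ b ≠ 0 := (map_ne_zero_iff φ hφ).2 hb0
    rw [← hy, map_div₀]
    exact div_mul_cancel₀ _ hb'
  have halg : IsAlgebraic Fq[X] f :=
    (IsFractionRing.isAlgebraic_iff Fq[X] (RatFunc Fq) F).2 (Algebra.IsAlgebraic.isAlgebraic f)
  obtain ⟨q, hq, hint⟩ := halg.exists_integral_multiple
  have hinj : Function.Injective (algebraMap Fq[X] F) := algebraMap_injective Fq F
  have hq' : algebraMap Fq[X] F q ≠ 0 := (map_ne_zero_iff _ hinj).2 hq
  have hqR : algebraMap Fq[X] R q ≠ 0 := fun h ↦ hq' (by rw [← hφX, h, map_zero])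
  obtain ⟨e, he, he'⟩ := ValuationSubring.exists_approx φ hφ hpow (hφO hO) hne hqR
  have hf : f = (q • f) / algebraMap Fq[X] F q := by
    rw [Algebra.smul_def, mul_div_cancel_left₀ _ hq']
  refine ⟨φ e / algebraMap Fq[X] F q * (q • f), ?_, fun O' hO' hne' hOO' ↦ ?_⟩
  · have := mul_mem he (mem_of_isIntegral hO hint)
    convert! this using 1
    nth_rw 1 [hf]
    rw [hφX, map_sub, map_one]
    ring
  · exact mul_mem (he' O' (hφO hO') hne' hOO') (mem_of_isIntegral hO' hint)

/-- Cocompactness of the ring `A` of functions regular outside `∞`, when `X` is regular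
at `∞`. -/
lemma exists_forall_exists_abs_sub_le_of_abs_X_le_one {absF : AbsoluteValue F ℝ}
    (hna : ∀ x y : F, absF (x + y) ≤ max (absF x) (absF y))
    (hnt : ∃ f, 1 < absF f) (hX : absF (algebraMap Fq[X] F Polynomial.X) ≤ 1) {A : Subring F}
    (hA : ∀ x : F, x ∈ A ↔ ∀ O : ValuationSubring F,
      (O : Set F) ≠ Set.univ → (O : Set F) ≠ {y : F | absF y ≤ 1} → x ∈ O) :
    ∃ C : ℝ, ∀ f : F, ∃ a ∈ A, absF (f - a) ≤ C := by
  obtain ⟨f₀, hf₀⟩ := hnt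
  let O := absF.valuationSubring hna
  have hne : O ≠ ⊤ := by
    intro h
    have : f₀ ∈ O := by rw [h]; exact ValuationSubring.mem_top f₀
    exact hf₀.not_ge (AbsoluteValue.mem_valuationSubring.1 this)
  obtain ⟨T, hT, hdec⟩ := exists_finite_decomposition (Fq := Fq) (F := F)
  let P (g t : F) : Prop := ∃ b r : F,
    (∀ O : ValuationSubring F, algebraMap Fq[X] F Polynomial.X ∉ O → b ∈ O) ∧
      (∀ O : ValuationSubring F, algebraMap Fq[X] F Polynomial.X ∈ O → r ∈ O) ∧ g = b + r + t
  let Reg (g : F) : Prop := ∀ O' : ValuationSubring F,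
      algebraMap Fq[X] F Polynomial.X ∈ O' → O' ≠ ⊤ → O' ≠ O → g ∈ O'
  have hrep (t : F) : ∃ c, (∃ g, Reg g ∧ P g t) → Reg c ∧ P c t := by
    by_cases h : ∃ g, Reg g ∧ P g t
    · exact ⟨h.choose, fun _ ↦ h.choose_spec⟩
    · exact ⟨0, fun h' ↦ absurd h' h⟩
  choose c hc using hrep
  obtain ⟨C, hC⟩ := (hT.image fun t ↦ absF (c t)).bddAbove
  refine ⟨max C 1, fun f ↦ ?_⟩
  obtain ⟨g, hfg, hg⟩ := exists_sub_mem (Fq := Fq) hX hne f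
  obtain ⟨b, r, t, hb, hr, ht, hgt⟩ := hdec g
  obtain ⟨hcreg, b', r', hb', hr', hct⟩ := hc t ⟨g, hg, b, r, hb, hr, hgt⟩
  have hbb : b - b' = g - c t - (r - r') := by rw [hgt, hct]; ring
  refine ⟨b - b', (hA _).2 fun O' h1 h2 ↦ ?_, ?_⟩
  · by_cases hXO : algebraMap Fq[X] F Polynomial.X ∈ O'
    · have h1' : O' ≠ ⊤ := fun h ↦ h1 (by rw [h]; rfl)
      have h2' : O' ≠ O := fun h ↦ h2 (by rw [h]; rfl)
      rw [hbb]
      exact sub_mem (sub_mem (hg O' hXO h1' h2') (hcreg O' hXO h1' h2'))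
        (sub_mem (hr O' hXO) (hr' O' hXO))
    · exact sub_mem (hb O' hXO) (hb' O' hXO)
  · have h3 : absF ((f - g) + (r - r')) ≤ 1 := add_mem (S := ValuationSubring F) (s := O)
      hfg (sub_mem (hr O hX) (hr' O hX))
    calc absF (f - (b - b')) = absF (c t + ((f - g) + (r - r'))) := by rw [hbb]; ring_nf
      _ ≤ max (absF (c t)) (absF ((f - g) + (r - r'))) := hna _ _
      _ ≤ max C 1 := max_le_max (hC ⟨t, ht, rfl⟩) h3

end

/-- The involution `X ↦ X⁻¹` of the field of rational functions. -/
noncomputable def ratFuncInv (K : Type*) [Field K] : RatFunc K →ₐ[K] RatFunc K :=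
  ((IntermediateField.val _).comp (RatFunc.algEquivOfTranscendental (RatFunc.X : RatFunc K)⁻¹
    (fun h ↦ RatFunc.transcendental_X (IsAlgebraic.inv_iff.1 h))).toAlgHom)

lemma ratFuncInv_X (K : Type*) [Field K] : ratFuncInv K RatFunc.X = RatFunc.X⁻¹ :=
  RatFunc.algEquivOfTranscendental_X _ _

lemma ratFuncInv_ratFuncInv (K : Type*) [Field K] (x : RatFunc K) :
    ratFuncInv K (ratFuncInv K x) = x := by
  have : (ratFuncInv K).comp (ratFuncInv K) = AlgHom.id K (RatFunc K) := by
    apply IsLocalization.algHom_ext (nonZeroDivisors K[X])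
    ext
    change ratFuncInv K (ratFuncInv K (algebraMap K[X] (RatFunc K) Polynomial.X)) =
      algebraMap K[X] (RatFunc K) Polynomial.X
    rw [RatFunc.algebraMap_X, ratFuncInv_X, map_inv₀, ratFuncInv_X, inv_inv]
  exact DFunLike.congr_fun this x

section

variable (Fq : Type*) {F : Type*} [Field Fq] [Finite Fq] [Field F] {absF : AbsoluteValue F ℝ}
  {A : Subring F}

lemma exists_forall_exists_abs_sub_le_of_abs_algebraMap_X_le_one [Algebra (RatFunc Fq) F]
    [FiniteDimensional (RatFunc Fq) F]
    (hna : ∀ x y : F, absF (x + y) ≤ max (absF x) (absF y))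
    (hnt : ∃ f, 1 < absF f) (hX : absF (algebraMap (RatFunc Fq) F RatFunc.X) ≤ 1)
    (hA : ∀ x : F, x ∈ A ↔ ∀ O : ValuationSubring F,
      (O : Set F) ≠ Set.univ → (O : Set F) ≠ {y : F | absF y ≤ 1} → x ∈ O) :
    ∃ C : ℝ, ∀ f : F, ∃ a ∈ A, absF (f - a) ≤ C := by
  let : Algebra Fq[X] F := Algebra.compHom F (algebraMap Fq[X] (RatFunc Fq))
  let : Algebra Fq F := Algebra.compHom F (algebraMap Fq Fq[X])
  have : IsScalarTower Fq[X] (RatFunc Fq) F := .of_algebraMap_eq fun _ ↦ rfl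
  have : IsScalarTower Fq Fq[X] F := .of_algebraMap_eq fun _ ↦ rfl
  refine exists_forall_exists_abs_sub_le_of_abs_X_le_one (Fq := Fq) hna hnt ?_ hA
  rwa [IsScalarTower.algebraMap_apply Fq[X] (RatFunc Fq) F, RatFunc.algebraMap_X]

/-- Cocompactness of the ring `A` of functions regular outside `∞`. -/
lemma exists_forall_exists_abs_sub_le [Algebra (RatFunc Fq) F] [FiniteDimensional (RatFunc Fq) F]
    (hna : ∀ x y : F, absF (x + y) ≤ max (absF x) (absF y))
    (hnt : ∃ f, 1 < absF f)
    (hA : ∀ x : F, x ∈ A ↔ ∀ O : ValuationSubring F,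
      (O : Set F) ≠ Set.univ → (O : Set F) ≠ {y : F | absF y ≤ 1} → x ∈ O) :
    ∃ C : ℝ, ∀ f : F, ∃ a ∈ A, absF (f - a) ≤ C := by
  by_cases hX : absF (algebraMap (RatFunc Fq) F RatFunc.X) ≤ 1
  · exact exists_forall_exists_abs_sub_le_of_abs_algebraMap_X_le_one Fq hna hnt hX hA
  · let ψ := (algebraMap (RatFunc Fq) F).comp (ratFuncInv Fq).toRingHom
    have hψ : ψ.Finite := RingHom.Finite.comp (RingHom.finite_algebraMap.2 inferInstance)
      (RingHom.Finite.of_surjective _ fun x ↦ ⟨_, ratFuncInv_ratFuncInv Fq x⟩)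
    refine @exists_forall_exists_abs_sub_le_of_abs_algebraMap_X_le_one Fq F _ _ _ absF A
      ψ.toAlgebra hψ hna hnt ?_ hA
    change absF (algebraMap (RatFunc Fq) F (ratFuncInv Fq RatFunc.X)) ≤ 1
    rw [ratFuncInv_X, map_inv₀, map_inv₀]
    exact inv_le_one_of_one_le₀ (not_le.1 hX).le

end

end FunctionField

/-- The valuation ring of a discrete absolute value is noetherian. -/
lemma AbsoluteValue.isNoetherianRing_valRing {F : Type*} [Field F] {abv : AbsoluteValue F ℝ}
    (hna : ∀ x y : F, abv (x + y) ≤ max (abv x) (abv y)) {c : ℕ} (hc : 1 < c)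
    (hdisc : ∀ x : F, x ≠ 0 → ∃ k : ℤ, abv x = (c : ℝ) ^ k) :
    IsNoetherianRing (abv.valRing hna) := by
  have hc' : (1 : ℝ) < c := by exact_mod_cast hc
  refine ⟨fun I ↦ ?_⟩
  by_cases hI : I = ⊥
  · rw [hI]; exact Submodule.fg_bot
  obtain ⟨x₀, hx₀, hx₀0⟩ := Submodule.exists_mem_ne_zero_of_ne_bot hI
  let P (k : ℤ) : Prop := ∃ x ∈ I, abv (x : F) = (c : ℝ) ^ k
  have hbdd : ∀ k, P k → k ≤ 0 := by
    rintro k ⟨x, -, hx⟩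
    have : (c : ℝ) ^ k ≤ (c : ℝ) ^ (0 : ℤ) := by rw [← hx, zpow_zero]; exact x.2
    exact (zpow_le_zpow_iff_right₀ hc').1 this
  obtain ⟨k₀, hk₀⟩ := hdisc x₀ (by simpa using hx₀0)
  obtain ⟨k, ⟨x, hxI, hx⟩, hmax⟩ := Int.exists_greatest_of_bdd ⟨0, hbdd⟩ ⟨k₀, x₀, hx₀, hk₀⟩
  have hx0 : (x : F) ≠ 0 := fun h ↦ by
    rw [h, map_zero] at hx
    exact (zpow_pos (zero_lt_one.trans hc') k).ne hx
  refine ⟨{x}, le_antisymm (by simpa [Submodule.span_le] using hxI) fun y hy ↦ ?_⟩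
  rw [Finset.coe_singleton, Submodule.mem_span_singleton]
  have hle : abv ((y : F) / x) ≤ 1 := by
    by_cases hy0 : (y : F) = 0
    · simp [hy0]
    obtain ⟨j, hj⟩ := hdisc y hy0
    rw [map_div₀, hx, hj]
    exact div_le_one_of_le₀ ((zpow_le_zpow_iff_right₀ hc').2 (hmax j ⟨y, hy, hj⟩))
      (zpow_pos (zero_lt_one.trans hc') k).le
  exact ⟨⟨(y : F) / x, hle⟩, Subtype.ext (div_mul_cancel₀ _ hx0)⟩

/-- Let `F` be a global function field with a place `∞`, `A ⊆ F` the ring of elements regular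
outside `∞`, and let `Λ` be an `A`-lattice.  Let `V = F ⊗_A Λ` carry the unique `∞`-adic
norm extending the norm of `Λ`.  Then for each real `r > 0` the ball
`V_{≤r} = {v ∈ V : ‖v‖ ≤ r}` is finitely generated as a module over the valuation ring
`O_{F,∞}` of the place `∞`. -/
theorem ball_fg_over_local_ring
    (Fq F : Type*) [Field Fq] [Fintype Fq] [Field F]
    [Algebra (RatFunc Fq) F] [FiniteDimensional (RatFunc Fq) F]
    (absF : AbsoluteValue F ℝ)
    (hna : ∀ x y : F, absF (x + y) ≤ max (absF x) (absF y))
    (c : ℕ) (hc : 1 < c)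
    (hdisc : ∀ x : F, x ≠ 0 → ∃ k : ℤ, absF x = (c : ℝ) ^ k)
    (hπ : ∃ π : F, absF π = (c : ℝ)⁻¹)
    (hres : ∃ S : Finset F, S.card = c ∧ ∀ x : F, absF x ≤ 1 →
      ∃! y, y ∈ S ∧ absF (x - y) < 1)
    (A : Subring F)
    (hA : ∀ x : F, x ∈ A ↔ ∀ O : ValuationSubring F,
      (O : Set F) ≠ Set.univ → (O : Set F) ≠ {y : F | absF y ≤ 1} → x ∈ O)
    -- the `A`-lattice `Λ`
    (Λ : Type*) [AddCommGroup Λ] [Module ↥A Λ]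
    [Module.Finite ↥A Λ] [Module.Projective ↥A Λ]
    (N : Λ → ℝ)
    (hN0 : ∀ l : Λ, 0 ≤ N l)
    (hNz : ∀ l : Λ, N l = 0 ↔ l = 0)
    (hNu : ∀ l l' : Λ, N (l + l') ≤ max (N l) (N l'))
    (hNs : ∀ (a : ↥A) (l : Λ), N (a • l) = absF (a : F) * N l)
    (hdiscrete : ∀ r : ℝ, 0 < r → {l : Λ | N l ≤ r}.Finite)
    -- the induced norm on `V = F ⊗_A Λ`
    (NV : F ⊗[↥A] Λ → ℝ)
    (hNV0 : ∀ v, 0 ≤ NV v)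
    (hNVz : ∀ v, NV v = 0 ↔ v = 0)
    (hNVu : ∀ v v', NV (v + v') ≤ max (NV v) (NV v'))
    (hNVs : ∀ (x : F) (v : F ⊗[↥A] Λ), NV (x • v) = absF x * NV v)
    (hNVext : ∀ l : Λ, NV ((1 : F) ⊗ₜ l) = N l) :
    ∀ (r : ℝ) (hr : 0 < r), (normBall absF hna NV hNV0 hNVu hNVs r hr).FG := by
  intro r hr
  have hc' : (1 : ℝ) < c := by exact_mod_cast hc
  obtain ⟨π, hπ⟩ := hπ
  have hπ1 : absF π⁻¹ = c := by rw [map_inv₀, hπ, inv_inv]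
  obtain ⟨C, hC⟩ := FunctionField.exists_forall_exists_abs_sub_le Fq hna
    ⟨π⁻¹, hπ1.symm ▸ hc'⟩ hA
  obtain ⟨k, hk⟩ := pow_unbounded_of_one_lt C hc'
  let e := π⁻¹ ^ k
  have he : absF e = (c : ℝ) ^ k := by rw [map_pow, hπ1]
  have hepos : 0 < absF e := he ▸ pow_pos (zero_lt_one.trans hc') k
  obtain ⟨n, g, hg⟩ := Module.Finite.exists_fin (R := A) (M := Λ)
  have hNV_sum {w : Fin n → F ⊗[A] Λ} {M : ℝ} (hM : 0 ≤ M) (hw : ∀ i, NV (w i) ≤ M) :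
      NV (∑ i, w i) ≤ M :=
    Finset.sum_induction w (NV · ≤ M) (fun _ _ h h' ↦ (hNVu _ _).trans (max_le h h'))
      (((hNVz 0).2 rfl).trans_le hM) fun i _ ↦ hw i
  have hdec (v : F ⊗[A] Λ) : ∃ (l : Λ) (y : Fin n → F), (∀ i, absF (y i) ≤ absF e) ∧
      v = 1 ⊗ₜ l + ∑ i, y i • ((1 : F) ⊗ₜ[A] g i) := by
    have hspan : Submodule.span F (Set.range fun i ↦ (1 : F) ⊗ₜ[A] g i) = ⊤ := by
      have := Submodule.baseChange_span (R := A) F (Set.range g)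
      rw [hg, Submodule.baseChange_top, ← Set.range_comp] at this
      exact this.symm
    obtain ⟨x, rfl⟩ := (Submodule.mem_span_range_iff_exists_fun F).1
      (hspan ▸ Submodule.mem_top : v ∈ _)
    choose a haA ha using fun i ↦ hC (x i)
    refine ⟨∑ i, (⟨a i, haA i⟩ : A) • g i, fun i ↦ x i - a i,
      fun i ↦ (ha i).trans (hk.le.trans he.ge), ?_⟩
    rw [TensorProduct.tmul_sum, ← Finset.sum_add_distrib]
    refine Finset.sum_congr rfl fun i _ ↦ ?_
    have : (1 : F) ⊗ₜ[A] ((⟨a i, haA i⟩ : A) • g i) = a i • ((1 : F) ⊗ₜ[A] g i) := by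
      rw [← TensorProduct.smul_tmul, TensorProduct.smul_tmul']
      rfl
    rw [this, ← add_smul, add_sub_cancel]
  obtain ⟨M, hM⟩ := (Set.finite_range fun i ↦ absF e * N (g i)).bddAbove
  have hfin := hdiscrete (max r (max M 0)) (hr.trans_le (le_max_left _ _))
  let S : Set (F ⊗[A] Λ) := (fun l ↦ 1 ⊗ₜ l) '' {l | N l ≤ max r (max M 0)} ∪
    Set.range fun i ↦ e • ((1 : F) ⊗ₜ g i)
  have hS : S.Finite := (hfin.image _).union (Set.finite_range _)
  have := AbsoluteValue.isNoetherianRing_valRing hna hc hdisc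
  refine Submodule.FG.of_le (Submodule.fg_span (R := absF.valRing hna) hS) fun v hv ↦ ?_
  obtain ⟨l, y, hy, rfl⟩ := hdec v
  have hw : NV (∑ i, y i • ((1 : F) ⊗ₜ[A] g i)) ≤ max M 0 := by
    refine hNV_sum (le_max_right _ _) fun i ↦ ?_
    rw [hNVs, hNVext]
    exact (mul_le_mul_of_nonneg_right (hy i) (hN0 _)).trans
      ((hM ⟨i, rfl⟩).trans (le_max_left _ _))
  refine add_mem (Submodule.subset_span (Or.inl ⟨l, ?_, rfl⟩)) (sum_mem fun i _ ↦ ?_)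
  · have hneg : NV (-∑ i, y i • ((1 : F) ⊗ₜ[A] g i)) ≤ max M 0 := by
      rw [← neg_one_smul F, hNVs, absF.map_neg, absF.map_one, one_mul]
      exact hw
    calc N l = NV (1 ⊗ₜ l + ∑ i, y i • ((1 : F) ⊗ₜ[A] g i) +
          -∑ i, y i • ((1 : F) ⊗ₜ[A] g i)) := by rw [add_neg_cancel_right, hNVext]
      _ ≤ max r (max M 0) := (hNVu _ _).trans (max_le_max hv hneg)
  · have hye : y i = y i / e * e := (div_mul_cancel₀ _ (absF.pos_iff.1 hepos)).symm
    have hle : absF (y i / e) ≤ 1 := by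
      rw [map_div₀]
      exact div_le_one_of_le₀ (hy i) hepos.le
    rw [hye, mul_smul]
    exact Submodule.smul_mem _ (⟨y i / e, hle⟩ : absF.valRing hna)
      (Submodule.subset_span (Or.inr ⟨i, rfl⟩))
end

section
/- Let φ(X) = α_0·X + α_1·X^q + … + α_{n+1}·X^{q^{n+1}} be an 𝔽_q-linear polynomial with coefficients in K such that α_0 ≠ 0 and α := α_{n+1} ≠ 0, and let V ⊂ K^s be its set of roots, an 𝔽_q-vector space of dimension n+1 stable under G_K. Let f : V → 𝔽_q be a surjective 𝔽_q-linear G_K-equivariant map, let v ∈ V satisfy f(v) = 1, and let w_1, …, w_n be an 𝔽_q-basis of ker(f). Set u = α^{−1}·(M(w_1,…,w_n)/M(w_1,…,w_n,v))^q. Then: (1) there exist b_0, …, b_n ∈ K such that the polynomial ψ_0(X) = b_0·X + b_1·X^q + … + b_n·X^{q^n} satisfies ψ_0(w) = f(w) for all w ∈ V and ψ_0(x)^q − ψ_0(x) = u·φ(x) for all x ∈ K^s; (2) the element u does not depend on the choices of v and of the basis w_1, …, w_n. -/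
/-- The Moore determinant `M(x₁, …, x_k) = det (xᵢ^(q^(j-1)))`. -/
noncomputable def mooreDet {Ks : Type*} [Field Ks] (q : ℕ) {k : ℕ} (x : Fin k → Ks) : Ks :=
  Matrix.det (Matrix.of fun i j : Fin k => x i ^ q ^ (j : ℕ))

theorem linearIndependent_snoc_of_notMem {F L : Type*} [Field F] [Field L] [Algebra F L]
    {n : ℕ} {w : Fin n → L} {v : L} (W : Submodule F L)
    (hw : LinearIndependent F w) (hwW : ∀ i, w i ∈ W) (hv : v ∉ W) :
    LinearIndependent F (Fin.snoc w v : Fin (n + 1) → L) :=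
  linearIndependent_finSnoc.mpr
    ⟨hw, fun h => hv (Submodule.span_le.mpr (Set.range_subset_iff.mpr hwW) h)⟩

/-- The `F`-linear map `x ↦ ∑ j, c j * x ^ q ^ j`, where `q` is the cardinality of `F`. -/
noncomputable def additivePoly (F : Type*) {L : Type*} [Field F] [Fintype F] [Field L] [Algebra F L]
    {k : ℕ} (c : Fin k → L) : L →ₗ[F] L :=
  ∑ j : Fin k, c j • (FiniteField.frobeniusAlgHom F L ^ (j : ℕ)).toLinearMap

section AdditivePoly

variable {F L : Type*} [Field F] [Fintype F] [Field L] [Algebra F L]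

theorem additivePoly_apply {k : ℕ} (c : Fin k → L) (x : L) :
    additivePoly F c x = ∑ j : Fin k, c j * x ^ Fintype.card F ^ (j : ℕ) := by
  simp [additivePoly, AlgHom.coe_pow, FiniteField.coe_frobeniusAlgHom, pow_iterate]

open Polynomial in
theorem eq_zero_of_additivePoly_eq_zero {k : ℕ} {e : Fin k → L} (he : LinearIndependent F e)
    {c : Fin k → L} (h : ∀ i, additivePoly F c (e i) = 0) : c = 0 := by
  have hq : 1 < Fintype.card F := Fintype.one_lt_card
  set P : L[X] := ∑ j : Fin k, C (c j) * X ^ Fintype.card F ^ (j : ℕ) with hP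
  have hroot : ∀ t : Fin k → F, P.eval (∑ i, t i • e i) = 0 := by
    intro t
    have hev : P.eval (∑ i, t i • e i) = additivePoly F c (∑ i, t i • e i) := by
      rw [additivePoly_apply, hP, eval_finsetSum]
      simp only [eval_mul, eval_C, eval_pow, eval_X]
    rw [hev, map_sum]
    exact Finset.sum_eq_zero fun i _ => by rw [map_smul, h, smul_zero]
  have hinj : Function.Injective fun t : Fin k → F => ∑ i, t i • e i :=
    he.fintypeLinearCombination_injective
  have hdeg : P.natDegree < Fintype.card (Fin k → F) := by
    rw [Fintype.card_fun, Fintype.card_fin]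
    refine Nat.lt_of_le_pred (by positivity) (natDegree_sum_le_of_forall_le _ _ fun j _ => ?_)
    exact (natDegree_C_mul_X_pow_le _ _).trans
      (Nat.le_pred_of_lt (Nat.pow_lt_pow_right hq j.isLt))
  have hzero : P = 0 := eq_zero_of_natDegree_lt_card_of_eval_eq_zero P hinj hroot hdeg
  funext j
  have hcoeff := congrArg (fun p => p.coeff (Fintype.card F ^ (j : ℕ))) hzero
  simpa [hP, coeff_X_pow, Nat.pow_right_inj hq, Fin.val_inj] using hcoeff

theorem moore_mulVec {k : ℕ} (e c : Fin k → L) (i : Fin k) :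
    (Matrix.of fun i j : Fin k => e i ^ Fintype.card F ^ (j : ℕ)).mulVec c i =
      additivePoly F c (e i) := by
  simp [Matrix.mulVec, dotProduct, additivePoly_apply, mul_comm]

theorem mooreDet_ne_zero {k : ℕ} {e : Fin k → L} (he : LinearIndependent F e) :
    mooreDet (Fintype.card F) e ≠ 0 := by
  intro h
  obtain ⟨c, hc, hc0⟩ := Matrix.exists_mulVec_eq_zero_iff.mpr h
  exact hc (eq_zero_of_additivePoly_eq_zero he fun i => by rw [← moore_mulVec, hc0, Pi.zero_apply])

theorem exists_additivePoly_eq {k : ℕ} {e : Fin k → L} (he : LinearIndependent F e)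
    (y : Fin k → L) : ∃ c : Fin k → L, ∀ i, additivePoly F c (e i) = y i := by
  let A := Matrix.of fun i j : Fin k => e i ^ Fintype.card F ^ (j : ℕ)
  have hA : IsUnit A.det := (mooreDet_ne_zero he).isUnit
  refine ⟨A⁻¹.mulVec y, fun i => ?_⟩
  rw [← moore_mulVec, Matrix.mulVec_mulVec, Matrix.mul_nonsing_inv A hA, Matrix.one_mulVec]

/-- Cramer's rule for the leading coefficient of an interpolating additive polynomial. -/
theorem coeff_last_eq_mooreDet_div {n : ℕ} {w : Fin n → L} {v : L}
    (he : LinearIndependent F (Fin.snoc w v : Fin (n + 1) → L)) {c : Fin (n + 1) → L}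
    (hw : ∀ i, additivePoly F c (w i) = 0) (hv : additivePoly F c v = 1) :
    c (Fin.last n) = mooreDet (Fintype.card F) w /
      mooreDet (Fintype.card F) (Fin.snoc w v : Fin (n + 1) → L) := by
  rw [eq_div_iff (mooreDet_ne_zero he), mul_comm]
  let A := Matrix.of fun i j : Fin (n + 1) =>
    (Fin.snoc w v : Fin (n + 1) → L) i ^ Fintype.card F ^ (j : ℕ)
  have hAc : A.mulVec c = Pi.single (Fin.last n) 1 := by
    funext i
    rw [moore_mulVec]
    induction i using Fin.lastCases with
    | last => simp [hv]
    | cast i => simp [hw, Fin.castSucc_ne_last]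
  have hadj : A.det * c (Fin.last n) = A.adjugate (Fin.last n) (Fin.last n) := by
    have h := congrArg (fun y => A.adjugate.mulVec y (Fin.last n)) hAc
    simpa [Matrix.mulVec_mulVec, Matrix.adjugate_mul, Matrix.smul_mulVec] using h
  have hminor : A.adjugate (Fin.last n) (Fin.last n) = mooreDet (Fintype.card F) w := by
    rw [Matrix.adjugate_fin_succ_eq_det_submatrix, Even.neg_one_pow ⟨_, rfl⟩, one_mul, mooreDet]
    congr 1
    ext i j
    simp [A]
  exact hadj.trans hminor

/-- The coefficients of `ψ ^ q - ψ`, where `ψ` is the additive polynomial with coefficients `c`. -/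
theorem additivePoly_pow_card_sub {n : ℕ} (c : Fin (n + 1) → L) (x : L) :
    additivePoly F c x ^ Fintype.card F - additivePoly F c x =
      additivePoly F ((Fin.cons 0 fun j => c j ^ Fintype.card F : Fin (n + 2) → L) -
        Fin.snoc c 0) x := by
  have hfrob : additivePoly F c x ^ Fintype.card F =
      ∑ j : Fin (n + 1), c j ^ Fintype.card F * x ^ Fintype.card F ^ ((j : ℕ) + 1) := by
    rw [additivePoly_apply]
    change FiniteField.frobeniusAlgHom F L _ = _
    rw [map_sum]
    simp [mul_pow, ← pow_mul, pow_succ]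
  rw [hfrob]
  simp only [additivePoly_apply, Pi.sub_apply, sub_mul, Finset.sum_sub_distrib]
  congr 1
  · simp [Fin.sum_univ_succ (n := n + 1)]
  · simp [Fin.sum_univ_castSucc (n := n + 1)]

end AdditivePoly

/-- Let `φ(X) = α₀X + α₁X^q + ⋯ + α_{n+1}X^(q^(n+1))` be an `𝔽_q`-linear polynomial over `K`
with `α₀ ≠ 0` and `α := α_{n+1} ≠ 0`, and let `V ⊆ K^s` be its set of roots.  Let
`f : V → 𝔽_q` be a surjective `𝔽_q`-linear `G_K`-equivariant map, let `v ∈ V` with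
`f v = 1`, and let `w₁, …, wₙ` be an `𝔽_q`-basis of `ker f`.  Set
`u = α⁻¹·(M(w₁,…,wₙ)/M(w₁,…,wₙ,v))^q`.  Then (1) there exist `b₀, …, bₙ ∈ K` such that
`ψ₀(X) = b₀X + ⋯ + bₙX^(q^n)` satisfies `ψ₀(w) = f(w)` for all `w ∈ V` and
`ψ₀(x)^q − ψ₀(x) = u·φ(x)` for all `x ∈ K^s`; and (2) `u` is independent of the choices
of `v` and of the basis `w₁, …, wₙ`. -/
theorem artin_schreier_factor
    (Fq K Ks : Type*) [Field Fq] [Fintype Fq] [Field K] [Field Ks]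
    [Algebra Fq K] [Algebra K Ks] [Algebra Fq Ks] [IsScalarTower Fq K Ks]
    [IsSepClosure K Ks]
    (q : ℕ) (hq : q = Fintype.card Fq)
    (n : ℕ) (α : Fin (n + 2) → K)
    (hα0 : α 0 ≠ 0) (hαtop : α (Fin.last (n + 1)) ≠ 0)
    (V : Set Ks)
    (hV : V = {x : Ks | ∑ i : Fin (n + 2), algebraMap K Ks (α i) * x ^ q ^ (i : ℕ) = 0})
    (f : Ks → Fq)
    (hf_add : ∀ x ∈ V, ∀ y ∈ V, f (x + y) = f x + f y)
    (hf_smul : ∀ (s : Fq), ∀ x ∈ V, f (algebraMap Fq Ks s * x) = s * f x)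
    (hf_surj : ∀ t : Fq, ∃ x ∈ V, f x = t)
    (hf_equiv : ∀ (g : Ks ≃ₐ[K] Ks), ∀ x ∈ V, f (g x) = f x)
    (v : Ks) (hv : v ∈ V) (hfv : f v = 1)
    (w : Fin n → Ks)
    (hw : ∀ i, w i ∈ V ∧ f (w i) = 0)
    (hw_indep : ∀ t : Fin n → Fq,
      (∑ i : Fin n, algebraMap Fq Ks (t i) * w i) = 0 → t = 0)
    (hw_span : ∀ x ∈ V, f x = 0 →
      ∃ t : Fin n → Fq, x = ∑ i : Fin n, algebraMap Fq Ks (t i) * w i)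
    (u : Ks)
    (hu : u = (algebraMap K Ks (α (Fin.last (n + 1))))⁻¹ *
      (mooreDet q w / mooreDet q (Fin.snoc w v)) ^ q) :
    (∃ b : Fin (n + 1) → K,
      (∀ x ∈ V, (∑ i : Fin (n + 1), algebraMap K Ks (b i) * x ^ q ^ (i : ℕ))
          = algebraMap Fq Ks (f x)) ∧
      (∀ x : Ks,
        (∑ i : Fin (n + 1), algebraMap K Ks (b i) * x ^ q ^ (i : ℕ)) ^ q
            - (∑ i : Fin (n + 1), algebraMap K Ks (b i) * x ^ q ^ (i : ℕ))
          = u * ∑ i : Fin (n + 2), algebraMap K Ks (α i) * x ^ q ^ (i : ℕ))) ∧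
    (∀ (v' : Ks), v' ∈ V → f v' = 1 →
      ∀ w' : Fin n → Ks, (∀ i, w' i ∈ V ∧ f (w' i) = 0) →
      (∀ t : Fin n → Fq, (∑ i : Fin n, algebraMap Fq Ks (t i) * w' i) = 0 → t = 0) →
      (∀ x ∈ V, f x = 0 →
        ∃ t : Fin n → Fq, x = ∑ i : Fin n, algebraMap Fq Ks (t i) * w' i) →
      (algebraMap K Ks (α (Fin.last (n + 1))))⁻¹ *
          (mooreDet q w' / mooreDet q (Fin.snoc w' v')) ^ q = u) := by
  subst hq
  set a : Fin (n + 2) → Ks := fun i => algebraMap K Ks (α i) with ha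
  have hmemV : ∀ x, x ∈ V ↔ additivePoly Fq a x = 0 := by
    intro x
    rw [hV, Set.mem_ofPred_eq, additivePoly_apply]
  have hf_smul' : ∀ (s : Fq), ∀ x ∈ V, f (s • x) = s * f x := by
    simpa only [Algebra.smul_def] using hf_smul
  have hV_add : ∀ x ∈ V, ∀ y ∈ V, x + y ∈ V := by
    intro x hx y hy
    rw [hmemV] at *
    rw [map_add, hx, hy, add_zero]
  have hV_smul : ∀ (s : Fq), ∀ x ∈ V, s • x ∈ V := by
    intro s x hx
    rw [hmemV] at *
    rw [map_smul, hx, smul_zero]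
  have hV_gal : ∀ (g : Ks ≃ₐ[K] Ks), ∀ x ∈ V, g x ∈ V := by
    intro g x hx
    rw [hV, Set.mem_ofPred_eq] at *
    simpa using congrArg g hx
  let W : Submodule Fq Ks :=
    { carrier := {x | x ∈ V ∧ f x = 0}
      add_mem' := fun {x y} hx hy =>
        ⟨hV_add x hx.1 y hy.1, by rw [hf_add x hx.1 y hy.1, hx.2, hy.2, add_zero]⟩
      zero_mem' := by
        refine ⟨by simpa using hV_smul 0 v hv, by simpa using hf_smul' 0 v hv⟩
      smul_mem' := fun s x hx =>
        ⟨hV_smul s x hx.1, by rw [hf_smul' s x hx.1, hx.2, mul_zero]⟩ }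
  have hindep : ∀ (v' : Ks), f v' = 1 → ∀ w' : Fin n → Ks, (∀ i, w' i ∈ V ∧ f (w' i) = 0) →
      (∀ t : Fin n → Fq, (∑ i : Fin n, algebraMap Fq Ks (t i) * w' i) = 0 → t = 0) →
      LinearIndependent Fq (Fin.snoc w' v' : Fin (n + 1) → Ks) := by
    intro v' hfv' w' hw' hw'_indep
    refine linearIndependent_snoc_of_notMem W ?_ hw' fun h => ?_
    · rw [Fintype.linearIndependent_iff]
      intro t ht i
      simp only [Algebra.smul_def] at ht
      exact congrFun (hw'_indep t ht) i
    · exact one_ne_zero (hfv'.symm.trans h.2)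
  have he := hindep v hfv w hw hw_indep
  have heV : ∀ j, (Fin.snoc w v : Fin (n + 1) → Ks) j ∈ V := by
    intro j
    induction j using Fin.lastCases with
    | last => simpa using hv
    | cast j => simpa using (hw j).1
  obtain ⟨c, hc⟩ := exists_additivePoly_eq he (Fin.snoc (fun _ => 0) 1)
  have hcw : ∀ i, additivePoly Fq c (w i) = 0 := fun i => by simpa using hc i.castSucc
  have hcv : additivePoly Fq c v = 1 := by simpa using hc (Fin.last n)
  have hcV : ∀ x ∈ V, additivePoly Fq c x = algebraMap Fq Ks (f x) := by
    intro x hx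
    have hmem := hV_smul (-f x) v hv
    obtain ⟨t, ht⟩ := hw_span (x + (-f x) • v) (hV_add x hx _ hmem)
      (by rw [hf_add x hx _ hmem, hf_smul' _ v hv, hfv]; ring)
    have hx' : x = f x • v + ∑ i, t i • w i := by
      simp only [Algebra.smul_def, ← ht, map_neg]
      ring
    conv_lhs => rw [hx', map_add, map_smul, hcv, map_sum]
    simp [hcw, Algebra.algebraMap_eq_smul_one]
  have hlast : ∀ (v' : Ks), v' ∈ V → f v' = 1 → ∀ w' : Fin n → Ks,
      (∀ i, w' i ∈ V ∧ f (w' i) = 0) →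
      (∀ t : Fin n → Fq, (∑ i : Fin n, algebraMap Fq Ks (t i) * w' i) = 0 → t = 0) →
      c (Fin.last n) = mooreDet (Fintype.card Fq) w' /
        mooreDet (Fintype.card Fq) (Fin.snoc w' v' : Fin (n + 1) → Ks) := by
    intro v' hv' hfv' w' hw' hw'_indep
    refine coeff_last_eq_mooreDet_div (hindep v' hfv' w' hw' hw'_indep) (fun i => ?_) ?_
    · rw [hcV _ (hw' i).1, (hw' i).2, map_zero]
    · rw [hcV _ hv', hfv', map_one]
  have hu' : u = (a (Fin.last (n + 1)))⁻¹ * c (Fin.last n) ^ Fintype.card Fq := by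
    rw [hu, hlast v hv hfv w hw hw_indep]
  have hgal : ∀ i, ∃ b : K, algebraMap K Ks b = c i := by
    intro i
    refine (InfiniteGalois.mem_range_algebraMap_iff_fixed (k := K) (c i)).mpr fun g => ?_
    have hsub : (fun j => g (c j)) - c = 0 := by
      refine eq_zero_of_additivePoly_eq_zero he fun j => ?_
      have hmem := heV j
      generalize (Fin.snoc w v : Fin (n + 1) → Ks) j = x at hmem
      have hy := hV_gal g.symm x hmem
      have hfy : f (g.symm x) = f x := hf_equiv g.symm x hmem
      have hgc : additivePoly Fq (fun j => g (c j)) x = algebraMap Fq Ks (f x) := by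
        have h := congrArg g (hcV _ hy)
        rw [hfy, IsScalarTower.algebraMap_apply Fq K Ks, AlgEquiv.commutes,
          ← IsScalarTower.algebraMap_apply] at h
        rw [← h]
        simp [additivePoly_apply]
      have hcx := hcV x hmem
      rw [additivePoly_apply] at hgc hcx ⊢
      simp only [Pi.sub_apply, sub_mul, Finset.sum_sub_distrib]
      rw [hgc, hcx, sub_self]
    exact sub_eq_zero.mp (congrFun hsub i)
  choose b hb using hgal
  refine ⟨⟨b, fun x hx => ?_, fun x => ?_⟩, ?_⟩
  · simp only [hb, ← additivePoly_apply]
    exact hcV x hx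
  · simp only [hb]
    rw [← additivePoly_apply, ← additivePoly_apply (F := Fq) a]
    have hdiff : ∀ y, additivePoly Fq c y ^ Fintype.card Fq - additivePoly Fq c y -
        u * additivePoly Fq a y =
        additivePoly Fq ((Fin.cons 0 fun j => c j ^ Fintype.card Fq : Fin (n + 2) → Ks) -
          Fin.snoc c 0 - u • a) y := by
      intro y
      rw [additivePoly_pow_card_sub]
      simp only [additivePoly_apply, Pi.sub_apply, Pi.smul_apply, smul_eq_mul, sub_mul,
        Finset.sum_sub_distrib, Finset.mul_sum, mul_assoc]
    set d : Fin (n + 2) → Ks := (Fin.cons 0 fun j => c j ^ Fintype.card Fq : Fin (n + 2) → Ks) -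
      Fin.snoc c 0 - u • a with hd
    have hatop : a (Fin.last (n + 1)) ≠ 0 := by simpa [ha] using hαtop
    have hdlast : d (Fin.last (n + 1)) = 0 := by
      simp only [hd, Pi.sub_apply, Pi.smul_apply, smul_eq_mul, Fin.snoc_last, hu']
      rw [← Fin.succ_last, Fin.cons_succ, Fin.succ_last]
      field_simp
      ring
    have htrunc : ∀ y, additivePoly Fq d y =
        additivePoly Fq (fun j : Fin (n + 1) => d j.castSucc) y := by
      intro y
      simp [additivePoly_apply, Fin.sum_univ_castSucc (n := n + 1), hdlast]
    have hdV : ∀ y ∈ V, additivePoly Fq d y = 0 := by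
      intro y hy
      rw [← hdiff, hcV y hy, (hmemV y).mp hy, ← map_pow, FiniteField.pow_card]
      ring
    have hzero : (fun j : Fin (n + 1) => d j.castSucc) = 0 := by
      refine eq_zero_of_additivePoly_eq_zero he fun j => ?_
      rw [← htrunc]
      exact hdV _ (heV j)
    rw [← sub_eq_zero, hdiff, htrunc, hzero]
    simp [additivePoly_apply]
  · intro v' hv' hfv' w' hw' hw'_indep _
    rw [← hlast v' hv' hfv' w' hw' hw'_indep, hu']
end
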